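/- There exists a constant c > 0 such that for every prime p > 2, every quadratic polynomial f(x) ∈ F_p[x] (degree exactly 2), every quadratic polynomial g(x,y) ∈ F_p[x,y] whose xy-coefficient is nonzero, and every set A ⊆ F_p with |A| ≤ p^(5/8), the set f(A) + A + g(A,A) = {f(a) + b + g(c,d) : a,b,c,d ∈ A} has cardinality at least c·|A|^(8/5). -/

import Mathlib

open Finset


namespace Rud

open MvPolynomial in
/-- restriction of a polynomial to the null line with parameters `l` -/
noncomputable def res {F : Type*} [Field F] (l : F × F × F) :
    MvPolynomial (Fin 3) F →ₐ[F] Polynomial F :=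
  MvPolynomial.aeval ![Polynomial.X, Polynomial.C l.1 * Polynomial.X + Polynomial.C l.2.1,
    Polynomial.C (l.1 ^ 2) * Polynomial.X + Polynomial.C (l.1 * l.2.1 + l.2.2)]

def pt {F : Type*} [Field F] (l : F × F × F) (s : F) : Fin 3 → F :=
  ![s, l.1 * s + l.2.1, l.1 ^ 2 * s + (l.1 * l.2.1 + l.2.2)]

/-- incidence of null lines -/
def inc {F : Type*} [Field F] (r b : F × F × F) : Prop :=
  r.2.2 - b.2.2 = r.2.1 * b.1 - b.2.1 * r.1

section
variable {F : Type*} [Field F]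

theorem eval_res (l : F × F × F) (P : MvPolynomial (Fin 3) F) (s : F) :
    (res l P).eval s = MvPolynomial.eval (pt l s) P := by
  induction P using MvPolynomial.induction_on with
  | C a => simp [res]
  | add p q hp hq => simp [hp, hq]
  | mul_X p i hp =>
    rw [map_mul, Polynomial.eval_mul, hp, map_mul]
    congr 1
    fin_cases i <;> simp [res, pt]

theorem natDegree_res_le (l : F × F × F) (P : MvPolynomial (Fin 3) F) :
    (res l P).natDegree ≤ P.totalDegree := by
  unfold res
  rw [MvPolynomial.aeval_def, MvPolynomial.eval₂_eq']
  apply Polynomial.natDegree_sum_le_of_forall_le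
  intro d hd
  refine (Polynomial.natDegree_C_mul_le _ _).trans ?_
  refine (Polynomial.natDegree_prod_le _ _).trans ?_
  refine le_trans ?_ (MvPolynomial.le_totalDegree hd)
  rw [Finsupp.sum_fintype _ _ (by simp)]
  apply Finset.sum_le_sum
  intro i _
  refine (Polynomial.natDegree_pow_le).trans ?_
  have : (![Polynomial.X, Polynomial.C l.1 * Polynomial.X + Polynomial.C l.2.1,
    Polynomial.C (l.1 ^ 2) * Polynomial.X + Polynomial.C (l.1 * l.2.1 + l.2.2)] i :
      Polynomial F).natDegree ≤ 1 := by
    fin_cases i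
    · simp
    · exact Polynomial.natDegree_linear_le
    · exact Polynomial.natDegree_linear_le
  nlinarith

theorem derivative_res (l : F × F × F) (P : MvPolynomial (Fin 3) F) :
    Polynomial.derivative (res l P) = res l (MvPolynomial.pderiv 0 P)
      + Polynomial.C l.1 * res l (MvPolynomial.pderiv 1 P)
      + Polynomial.C (l.1 ^ 2) * res l (MvPolynomial.pderiv 2 P) := by
  induction P using MvPolynomial.induction_on with
  | C a => simp [res]
  | add p q hp hq => simp [hp, hq]; ring
  | mul_X p i hp =>
    rw [map_mul, Polynomial.derivative_mul, hp]
    simp only [MvPolynomial.pderiv_mul, map_add, map_mul]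
    have h2 : Polynomial.derivative (Polynomial.C l.1 ^ 2) = 0 := by
      rw [← Polynomial.C_pow, Polynomial.derivative_C]
    fin_cases i <;>
      simp [res, MvPolynomial.pderiv_X, h2] <;> ring

theorem pderiv_comm (i j : Fin 3) (P : MvPolynomial (Fin 3) F) :
    MvPolynomial.pderiv i (MvPolynomial.pderiv j P) =
      MvPolynomial.pderiv j (MvPolynomial.pderiv i P) := by
  induction P using MvPolynomial.induction_on with
  | C a => simp
  | add p q hp hq => simp [hp, hq]
  | mul_X p k hp =>
    simp only [MvPolynomial.pderiv_mul, map_add, hp, MvPolynomial.pderiv_X]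
    have h1 : ∀ a b : Fin 3, (MvPolynomial.pderiv a)
      (Pi.single (M := fun _ => MvPolynomial (Fin 3) F) b 1 k) = 0 := by
      intro a b
      by_cases h : k = b
      · subst h; simp
      · simp [h]
    simp only [h1]
    ring

theorem totalDegree_pderiv_le (i : Fin 3) (P : MvPolynomial (Fin 3) F) :
    (MvPolynomial.pderiv i P).totalDegree ≤ P.totalDegree - 1 := by
  rw [MvPolynomial.totalDegree]
  apply Finset.sup_le
  intro m hm
  rw [MvPolynomial.mem_support_iff, MvPolynomial.coeff_pderiv] at hm
  have h1 : m + Finsupp.single i 1 ∈ P.support := by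
    rw [MvPolynomial.mem_support_iff]
    intro h0
    rw [h0] at hm
    simp at hm
  have h2 := MvPolynomial.le_totalDegree h1
  rw [Finsupp.sum_add_index' (by simp) (by simp), Finsupp.sum_single_index rfl] at h2
  omega

theorem eq_C_of_pderiv_zero {p : ℕ} [CharP F p] (P : MvPolynomial (Fin 3) F)
    (hd : P.totalDegree < p) (h : ∀ i, MvPolynomial.pderiv i P = 0) :
    P.totalDegree = 0 := by
  by_contra hne
  obtain ⟨m, hm, hmd⟩ : ∃ m ∈ P.support, m ≠ 0 := by
    by_contra hcon
    push Not at hcon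
    apply hne
    rw [MvPolynomial.totalDegree_eq_zero_iff]
    intro m hm i
    simp [hcon m hm]
  obtain ⟨i, hi⟩ : ∃ i, m i ≠ 0 := by
    by_contra hcon
    push Not at hcon
    exact hmd (Finsupp.ext hcon)
  have hc := MvPolynomial.coeff_pderiv (i := i) P (m - Finsupp.single i 1)
  have hle : Finsupp.single i 1 ≤ m := by
    rw [Finsupp.single_le_iff]; omega
  rw [h i, MvPolynomial.coeff_zero, tsub_add_cancel_of_le hle] at hc
  have hmi : m i ≤ P.totalDegree := by
    refine le_trans ?_ (MvPolynomial.le_totalDegree hm)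
    rw [Finsupp.sum_fintype _ _ (by simp)]
    exact Finset.single_le_sum (f := fun i => m i) (by simp) (Finset.mem_univ i)
  have hc2 : (((m i : ℕ) : F)) = 0 := by
    rw [MvPolynomial.mem_support_iff] at hm
    have h3 := (mul_eq_zero.1 hc.symm).resolve_left hm
    have h4 : m i = (m i - 1) + 1 := by omega
    rw [h4]
    push_cast
    simpa using h3
  rw [CharP.cast_eq_zero_iff F p] at hc2
  have := Nat.le_of_dvd (by omega) hc2
  omega

theorem wronsk_deg {p : ℕ} [CharP F p] (a e : Polynomial F) (ha : a ≠ 0) (he : e ≠ 0)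
    (hap : a.natDegree < p) (hep : e.natDegree < p)
    (h : Polynomial.derivative a * e = a * Polynomial.derivative e) :
    a.natDegree = e.natDegree := by
  have hX : ∀ (q : Polynomial F) (n : ℕ), (Polynomial.X * Polynomial.derivative q).coeff n
      = n * q.coeff n := by
    intro q n
    cases n with
    | zero => simp
    | succ n => rw [Polynomial.coeff_X_mul, Polynomial.coeff_derivative]; push_cast; ring
  have hXd : ∀ (q : Polynomial F), (Polynomial.X * Polynomial.derivative q).natDegree
      ≤ q.natDegree := by
    intro q
    rw [Polynomial.natDegree_le_iff_coeff_eq_zero]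
    intro n hn
    rw [hX, Polynomial.coeff_eq_zero_of_natDegree_lt hn, mul_zero]
  have h1 : (Polynomial.X * Polynomial.derivative a) * e
      = a * (Polynomial.X * Polynomial.derivative e) := by
    rw [mul_assoc, h]; ring
  have h2 := congrArg (fun q => q.coeff (a.natDegree + e.natDegree)) h1
  rw [Polynomial.coeff_mul_add_eq_of_natDegree_le (hXd a) le_rfl,
    Polynomial.coeff_mul_add_eq_of_natDegree_le le_rfl (hXd e), hX, hX] at h2
  have h3 : a.coeff a.natDegree ≠ 0 := by simpa using ha
  have h4 : e.coeff e.natDegree ≠ 0 := by simpa using he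
  have h5 : ((a.natDegree : ℕ) : F) = ((e.natDegree : ℕ) : F) := by
    apply mul_right_cancel₀ (mul_ne_zero h3 h4)
    linear_combination h2
  exact CharP.natCast_injOn_Iio F p hap hep h5

/-- Wronskian lemma -/
theorem wronsk {p : ℕ} [CharP F p] (a e : Polynomial F) (he : e ≠ 0) (hap : a.natDegree < p)
    (hep : e.natDegree < p)
    (h : Polynomial.derivative a * e = a * Polynomial.derivative e) :
    ∃ c : F, a = Polynomial.C c * e := by
  by_cases ha : a = 0
  · exact ⟨0, by simp [ha]⟩
  have hd := wronsk_deg a e ha he hap hep h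
  have h4 : e.coeff e.natDegree ≠ 0 := by simpa using he
  refine ⟨a.coeff e.natDegree / e.coeff e.natDegree, ?_⟩
  set c := a.coeff e.natDegree / e.coeff e.natDegree with hc
  by_contra hne
  have hb : a - Polynomial.C c * e ≠ 0 := sub_ne_zero.2 hne
  have hbd : (a - Polynomial.C c * e).natDegree ≤ e.natDegree := by
    refine (Polynomial.natDegree_sub_le _ _).trans ?_
    apply max_le hd.le
    exact Polynomial.natDegree_C_mul_le _ _
  have h5 := wronsk_deg (p := p) (a - Polynomial.C c * e) e hb he (by omega) hep (by
    simp only [Polynomial.derivative_sub, Polynomial.derivative_mul, Polynomial.derivative_C]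
    linear_combination h)
  have h6 : (a - Polynomial.C c * e).coeff (a - Polynomial.C c * e).natDegree ≠ 0 := by
    simpa using hb
  apply h6
  rw [h5, Polynomial.coeff_sub, Polynomial.coeff_C_mul, hc]
  field_simp
  ring
end
end Rud

namespace Rud
section
variable {F : Type*} [Field F]

theorem card_deg_le (k : ℕ) :
    6 * ((range (k+1)).biUnion (fun j => (univ : Finset (Fin 3)).finsuppAntidiag j)).card
      = (k+1)*(k+2)*(k+3) := by
  rw [Finset.card_biUnion]
  · induction k with
    | zero => simp
    | succ k ih =>
      rw [Finset.sum_range_succ, mul_add, ih, Finset.card_finsuppAntidiag_nat_eq_choose]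
      have : (Finset.univ : Finset (Fin 3)).card + (k+1) - 1 = k + 1 + 2 := by
        simp; omega
      rw [this, Nat.choose_symm_add]
      have h2 := Nat.choose_two_right (k+1+2)
      have h3 : (k+1+2).choose 2 * 2 = (k+1+2) * (k+1+2-1) := by
        rw [h2]; exact Nat.div_mul_cancel (Nat.even_mul_pred_self _).two_dvd
      have h4 : k+1+2-1 = k+2 := by omega
      rw [h4] at h3
      nlinarith
  · intro i _ j _ hij
    rw [Function.onFun, Finset.disjoint_left]
    intro m hm hm'
    rw [Finset.mem_finsuppAntidiag] at hm hm'
    exact hij (hm.1.symm.trans hm'.1)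

theorem finrank_deg (k : ℕ) :
    6 * Module.finrank F (MvPolynomial.restrictTotalDegree (Fin 3) F k) = (k+1)*(k+2)*(k+3) := by
  rw [← card_deg_le]
  congr 1
  have hs : {n : Fin 3 →₀ ℕ | (n.sum fun _ e => e) ≤ k} =
      (((range (k+1)).biUnion (fun j => (univ : Finset (Fin 3)).finsuppAntidiag j) :
        Finset (Fin 3 →₀ ℕ)) : Set (Fin 3 →₀ ℕ)) := by
    ext n
    simp only [Set.mem_ofPred_eq, Finset.coe_biUnion, Set.mem_iUnion, Finset.mem_coe,
      Finset.mem_finsuppAntidiag, Finset.mem_range]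
    rw [Finsupp.sum_fintype _ _ (by simp)]
    constructor
    · intro h
      exact ⟨_, Nat.lt_succ_of_le h, rfl, by simp⟩
    · rintro ⟨j, hj, h, -⟩
      have h' : ∑ i, n i = j := h
      omega
  rw [MvPolynomial.restrictTotalDegree, hs,
    Module.finrank_eq_card_basis (MvPolynomial.basisRestrictSupport F _)]
  simp

/-- interpolation -/
theorem exists_interp (S : Finset (F × F × F)) (D : ℕ) (hD : 6 * S.card ≤ D ^ 2) :
    ∃ P : MvPolynomial (Fin 3) F, P ≠ 0 ∧ P.totalDegree ≤ D ∧ ∀ l ∈ S, res l P = 0 := by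
  classical
  let φ : MvPolynomial (Fin 3) F →ₗ[F] (S → Fin (D+1) → F) :=
    LinearMap.pi (fun l => LinearMap.pi (fun i =>
      (Polynomial.lcoeff F (i : ℕ)) ∘ₗ (res l.1).toLinearMap))
  let ψ := φ ∘ₗ (MvPolynomial.restrictTotalDegree (Fin 3) F D).subtype
  have hk : LinearMap.ker ψ ≠ ⊥ := by
    apply LinearMap.ker_ne_bot_of_finrank_lt
    have h1 := finrank_deg (F := F) D
    have h2 : Module.finrank F (S → Fin (D+1) → F) = S.card * (D+1) := by
      rw [Module.finrank_pi_fintype]; simp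
    rw [h2]
    have h3 : 6 * S.card < (D+2)*(D+3) := by nlinarith
    have h4 : 6 * (S.card * (D+1)) < (D+1)*(D+2)*(D+3) := by nlinarith
    omega
  obtain ⟨x, hx, hx0⟩ := (Submodule.ne_bot_iff _).1 hk
  refine ⟨x.1, fun h => hx0 (Subtype.ext h), (MvPolynomial.mem_restrictTotalDegree _ _ _).1 x.2, ?_⟩
  intro l hl
  ext n
  rw [Polynomial.coeff_zero]
  by_cases hn : n < D + 1
  · exact congrFun (congrFun (LinearMap.mem_ker.1 hx) ⟨l, hl⟩) ⟨n, hn⟩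
  · apply Polynomial.coeff_eq_zero_of_natDegree_lt
    have := natDegree_res_le l x.1
    have := (MvPolynomial.mem_restrictTotalDegree _ _ _).1 x.2
    omega

theorem totalDegree_aeval_X (c : Polynomial F) :
    (Polynomial.aeval (MvPolynomial.X 0 : MvPolynomial (Fin 3) F) c).totalDegree ≤ c.natDegree := by
  rw [Polynomial.aeval_eq_sum_range]
  refine (MvPolynomial.totalDegree_finsetSum _ _).trans ?_
  apply Finset.sup_le
  intro i hi
  refine (MvPolynomial.totalDegree_smul_le _ _).trans ?_
  rw [MvPolynomial.totalDegree_X_pow]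
  simp at hi; omega

theorem res_aeval_X (l : F × F × F) (c : Polynomial F) :
    res l (Polynomial.aeval (MvPolynomial.X 0 : MvPolynomial (Fin 3) F) c) = c := by
  rw [← Polynomial.aeval_algHom_apply]
  simp [res]

theorem exists_sep_pair (a b : F × F × F) (h : a ≠ b) :
    ∃ L : MvPolynomial (Fin 3) F, L.totalDegree ≤ 1 ∧ res b L = 0 ∧ res a L ≠ 0 := by
  by_cases h1 : a.1 = b.1 ∧ a.2.1 = b.2.1
  · refine ⟨MvPolynomial.X 2 - (MvPolynomial.C b.1 * MvPolynomial.X 1 + MvPolynomial.C b.2.2), ?_, ?_, ?_⟩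
    · refine (MvPolynomial.totalDegree_sub _ _).trans (max_le (by simp) ?_)
      refine (MvPolynomial.totalDegree_add _ _).trans (max_le ?_ (by simp))
      refine (MvPolynomial.totalDegree_mul _ _).trans (by simp)
    · simp [res]; ring
    · have h2 : a.2.2 - b.2.2 ≠ 0 := by
        intro h2
        exact h (Prod.ext h1.1 (Prod.ext h1.2 (sub_eq_zero.1 h2)))
      intro h3
      apply h2
      have h4 := congrArg (fun q => Polynomial.eval 0 q) h3
      simp [res, h1.1, h1.2] at h4
      linear_combination h4
  · refine ⟨MvPolynomial.X 1 - (MvPolynomial.C b.1 * MvPolynomial.X 0 + MvPolynomial.C b.2.1), ?_, ?_, ?_⟩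
    · refine (MvPolynomial.totalDegree_sub _ _).trans (max_le (by simp) ?_)
      refine (MvPolynomial.totalDegree_add _ _).trans (max_le ?_ (by simp))
      refine (MvPolynomial.totalDegree_mul _ _).trans (by simp)
    · simp [res]
    · intro h3
      apply h1
      have h4 := congrArg (fun q => Polynomial.eval 0 q) h3
      have h5 := congrArg (fun q => Polynomial.eval 1 q) h3
      simp [res] at h4 h5
      exact ⟨by linear_combination h5 - h4, by linear_combination h4⟩

theorem exists_sep (S : Finset (F × F × F)) (a : F × F × F) (ha : a ∈ S) :
    ∃ L : MvPolynomial (Fin 3) F, L.totalDegree + 1 ≤ S.card ∧ (∀ b ∈ S, b ≠ a → res b L = 0) ∧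
      res a L ≠ 0 := by
  classical
  have h : ∀ b : F × F × F, ∃ L : MvPolynomial (Fin 3) F, b ≠ a →
      (L.totalDegree ≤ 1 ∧ res b L = 0 ∧ res a L ≠ 0) := by
    intro b
    by_cases hb : b = a
    · exact ⟨0, fun h => absurd hb h⟩
    · obtain ⟨L, hL⟩ := exists_sep_pair a b (Ne.symm hb)
      exact ⟨L, fun _ => hL⟩
  choose L hL using h
  refine ⟨∏ b ∈ S.erase a, L b, ?_, ?_, ?_⟩
  · have h1 : (∏ b ∈ S.erase a, L b).totalDegree ≤ ∑ b ∈ S.erase a, 1 :=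
      (MvPolynomial.totalDegree_finsetProd _ _).trans
        (Finset.sum_le_sum fun b hb => (hL b (Finset.ne_of_mem_erase hb)).1)
    have h2 := Finset.card_erase_add_one ha
    simp at h1
    omega
  · intro b hb hne
    rw [map_prod]
    exact Finset.prod_eq_zero (Finset.mem_erase.2 ⟨hne, hb⟩) (hL b hne).2.1
  · rw [map_prod]
    exact Finset.prod_ne_zero_iff.2 fun b hb => (hL b (Finset.ne_of_mem_erase hb)).2.2

theorem bezout_arith (m D E k : ℕ) (n0 n1 n2 n3 : ℕ) (hk : k = m^2 + D + E + m) (hm : 1 ≤ m)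
    (h0 : 6 * n0 = (k+1)*(k+2)*(k+3))
    (h1 : 6 * n1 = (k-D+1)*(k-D+2)*(k-D+3))
    (h2 : 6 * n2 = (k-E+1)*(k-E+2)*(k-E+3))
    (h3 : 6 * n3 = (k-D-E+1)*(k-D-E+2)*(k-D-E+3))
    (h : n1 + (n2 + m * (k+2-m)) ≤ n0 + n3) : m ≤ D * E := by
  obtain ⟨n, hn⟩ : ∃ n, n = m ^ 2 + m := ⟨_, rfl⟩
  have e1 : k - D = n + E := by omega
  have e2 : k - E = n + D := by omega
  have e3 : k - D - E = n := by omega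
  have e4 : k = n + D + E := by omega
  have e5 : k + 2 - m = m ^ 2 + D + E + 2 := by omega
  rw [e3] at h3
  rw [e1] at h1
  rw [e2] at h2
  rw [e5] at h
  rw [e4] at h0
  by_contra hc
  push Not at hc
  have h6 : 6 * (m * (m ^ 2 + D + E + 2)) ≤ D * E * (6 * n + 3 * D + 3 * E + 12) := by
    nlinarith
  have h7 : D * E * (6 * n + 3 * D + 3 * E + 12) ≤ D * E * (6 * (n + D + E + 2)) := by
    apply Nat.mul_le_mul_left; omega
  have h8 : (D * E + 1) * (6 * (n + D + E + 2)) ≤ m * (6 * (n + D + E + 2)) :=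
    Nat.mul_le_mul_right _ hc
  have h9 : m * (6 * (n + D + E + 2)) = 6 * (m * (m ^ 2 + D + E + 2)) + 6 * m ^ 2 := by
    rw [hn]; ring
  nlinarith

/-- weak Bezout for lines contained in two surfaces -/
theorem bezout (P Q : MvPolynomial (Fin 3) F) (hP : Irreducible P) (hPQ : ¬ P ∣ Q)
    (S : Finset (F × F × F)) (hSP : ∀ l ∈ S, res l P = 0) (hSQ : ∀ l ∈ S, res l Q = 0) :
    S.card ≤ P.totalDegree * Q.totalDegree := by
  classical
  have hprime : Prime P := hP.prime
  have hP0 : P ≠ 0 := hP.ne_zero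
  have hQ0 : Q ≠ 0 := fun h => hPQ (h ▸ dvd_zero _)
  rcases Nat.eq_zero_or_pos S.card with hm | hm
  · omega
  set D := P.totalDegree with hD
  set E := Q.totalDegree with hE
  set m := S.card with hmd
  obtain ⟨k, hk⟩ : ∃ k, k = m^2 + D + E + m := ⟨_, rfl⟩
  have hsep : ∀ a : S, ∃ L : MvPolynomial (Fin 3) F, L.totalDegree + 1 ≤ S.card ∧
      (∀ b ∈ S, b ≠ a.1 → res b L = 0) ∧ res a.1 L ≠ 0 := fun a => exists_sep S a.1 a.2
  choose H hH using hsep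
  let V := fun j => MvPolynomial.restrictTotalDegree (Fin 3) F j
  let Θ : (V (k-D) × V (k-E) × (S → Polynomial.degreeLT F (k+2-m))) →ₗ[F] MvPolynomial (Fin 3) F :=
    LinearMap.coprod ((LinearMap.mulLeft F P) ∘ₗ (V (k-D)).subtype)
      (LinearMap.coprod ((LinearMap.mulLeft F Q) ∘ₗ (V (k-E)).subtype)
        (LinearMap.lsum F (fun _ => Polynomial.degreeLT F (k+2-m)) F (fun a : S =>
          (LinearMap.mulLeft F (H a)) ∘ₗ
            (Polynomial.aeval (MvPolynomial.X 0 : MvPolynomial (Fin 3) F)).toLinearMap ∘ₗ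
              (Polynomial.degreeLT F (k+2-m)).subtype)))
  have hΘ : ∀ x, Θ x = P * x.1.1 + (Q * x.2.1.1 + ∑ a : S, H a *
      (Polynomial.aeval (MvPolynomial.X 0 : MvPolynomial (Fin 3) F) (x.2.2 a).1)) := by
    intro x
    simp [Θ, LinearMap.lsum_apply]
  let Ψ : V (k-D-E) →ₗ[F] (V (k-D) × V (k-E) × (S → Polynomial.degreeLT F (k+2-m))) :=
    LinearMap.prod
      (LinearMap.codRestrict (V (k-D)) ((LinearMap.mulLeft F Q) ∘ₗ (V (k-D-E)).subtype) (by
        intro c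
        have hc := (MvPolynomial.mem_restrictTotalDegree _ _ _).1 c.2
        rw [MvPolynomial.mem_restrictTotalDegree]
        refine (MvPolynomial.totalDegree_mul _ _).trans ?_
        simp only [Submodule.subtype_apply]
        omega))
      (LinearMap.prod
        (LinearMap.codRestrict (V (k-E)) (-(LinearMap.mulLeft F P) ∘ₗ (V (k-D-E)).subtype) (by
          intro c
          have hc := (MvPolynomial.mem_restrictTotalDegree _ _ _).1 c.2
          rw [MvPolynomial.mem_restrictTotalDegree]
          simp only [LinearMap.neg_apply, MvPolynomial.totalDegree_neg]
          refine (MvPolynomial.totalDegree_mul _ _).trans ?_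
          simp only [Submodule.subtype_apply]
          omega)) 0)
  have hrange : Module.finrank F (LinearMap.range Θ) ≤ Module.finrank F (V k) := by
    apply Submodule.finrank_mono
    rintro _ ⟨x, rfl⟩
    rw [hΘ, MvPolynomial.mem_restrictTotalDegree]
    have h1 := (MvPolynomial.mem_restrictTotalDegree _ _ _).1 x.1.2
    have h2 := (MvPolynomial.mem_restrictTotalDegree _ _ _).1 x.2.1.2
    refine (MvPolynomial.totalDegree_add _ _).trans (max_le ?_ ?_)
    · refine (MvPolynomial.totalDegree_mul _ _).trans ?_
      omega
    refine (MvPolynomial.totalDegree_add _ _).trans (max_le ?_ ?_)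
    · refine (MvPolynomial.totalDegree_mul _ _).trans ?_
      omega
    refine (MvPolynomial.totalDegree_finsetSum _ _).trans ?_
    apply Finset.sup_le
    intro a _
    refine (MvPolynomial.totalDegree_mul _ _).trans ?_
    have h3 := totalDegree_aeval_X (x.2.2 a).1
    have h4 := (hH a).1
    have h5 : (x.2.2 a).1.natDegree < k + 2 - m := by
      have h6 := Polynomial.mem_degreeLT.1 (x.2.2 a).2
      by_cases h7 : (x.2.2 a).1 = 0
      · rw [h7]; simp; omega
      · exact (Polynomial.natDegree_lt_iff_degree_lt h7).2 h6
    omega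
  have hker : Module.finrank F (LinearMap.ker Θ) ≤ Module.finrank F (V (k-D-E)) := by
    refine le_trans ?_ (LinearMap.finrank_range_le Ψ)
    apply Submodule.finrank_mono
    intro x hx
    rw [LinearMap.mem_ker, hΘ] at hx
    have hc : ∀ a, x.2.2 a = 0 := by
      intro a
      have h1 := congrArg (res a.1) hx
      simp only [map_add, map_mul, map_sum, hSP a.1 a.2, hSQ a.1 a.2, res_aeval_X, zero_mul,
        zero_add, map_zero] at h1
      rw [Finset.sum_eq_single a] at h1
      · exact Subtype.ext ((mul_eq_zero.1 h1).resolve_left (hH a).2.2)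
      · intro b _ hb
        rw [(hH b).2.1 a.1 a.2 (fun h => hb (Subtype.ext h.symm)), zero_mul]
      · simp
    simp only [hc, ZeroMemClass.coe_zero, map_zero, mul_zero, Finset.sum_const_zero, add_zero] at hx
    have hdvd : P ∣ x.2.1.1 := by
      refine (hprime.dvd_or_dvd (a := Q) ?_).resolve_left hPQ
      exact ⟨-x.1.1, by linear_combination hx⟩
    obtain ⟨c, hc'⟩ := hdvd
    have h2 : x.1.1 = Q * (-c) := by
      apply mul_left_cancel₀ hP0
      rw [hc'] at hx
      linear_combination hx
    have hcd : (-c).totalDegree ≤ k - D - E := by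
      rw [MvPolynomial.totalDegree_neg]
      by_cases hc0 : c = 0
      · simp [hc0]
      · have h3 := (MvPolynomial.mem_restrictTotalDegree _ _ _).1 x.2.1.2
        rw [hc', MvPolynomial.totalDegree_mul_of_isDomain hP0 hc0] at h3
        omega
    refine ⟨⟨-c, (MvPolynomial.mem_restrictTotalDegree _ _ _).2 hcd⟩, ?_⟩
    apply Prod.ext
    · apply Subtype.ext
      simp [Ψ, h2]
    · apply Prod.ext
      · apply Subtype.ext
        simp [Ψ, hc']
      · funext a
        simp [Ψ, hc a]
  have hrk := LinearMap.finrank_range_add_finrank_ker Θ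
  have hdim : Module.finrank F (V (k-D) × V (k-E) × (S → Polynomial.degreeLT F (k+2-m))) =
      Module.finrank F (V (k-D)) + (Module.finrank F (V (k-E)) + m * (k+2-m)) := by
    have hl : Module.finrank F (Polynomial.degreeLT F (k+2-m)) = k+2-m := by
      rw [(Polynomial.degreeLTEquiv F (k+2-m)).finrank_eq]; simp
    have : Module.Finite F (Polynomial.degreeLT F (k+2-m)) :=
      Module.Finite.equiv (Polynomial.degreeLTEquiv F (k+2-m)).symm
    have : Module.Free F (Polynomial.degreeLT F (k+2-m)) := inferInstance
    have h3 : Module.finrank F (S → Polynomial.degreeLT F (k+2-m)) = m * (k+2-m) := by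
      rw [Module.finrank_pi_fintype]
      simp [hl, hmd]
    rw [Module.finrank_prod, Module.finrank_prod, h3]
  refine bezout_arith m D E k _ _ _ _ hk hm (finrank_deg (F := F) k) (finrank_deg (F := F) (k-D))
    (finrank_deg (F := F) (k-E)) (finrank_deg (F := F) (k-D-E)) ?_
  change Module.finrank F (V (k-D)) + (Module.finrank F (V (k-E)) + m * (k+2-m)) ≤
    Module.finrank F (V k) + Module.finrank F (V (k-D-E))
  omega
end
end Rud

namespace Rud
section
variable {F : Type*} [Field F]
open MvPolynomial (pderiv)

noncomputable def Utt (P : MvPolynomial (Fin 3) F) : MvPolynomial (Fin 3) F :=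
  -(pderiv 1 (pderiv 1 P) * (pderiv 2 P * pderiv 2 P)
    - (pderiv 1 P * (pderiv 2 P * pderiv 1 (pderiv 2 P)) +
      pderiv 1 P * (pderiv 2 P * pderiv 1 (pderiv 2 P)))
    + pderiv 1 P * (pderiv 1 P * pderiv 2 (pderiv 2 P)))

noncomputable def Ust (P : MvPolynomial (Fin 3) F) : MvPolynomial (Fin 3) F :=
  -(pderiv 0 (pderiv 1 P) * (pderiv 2 P * pderiv 2 P)
    - (pderiv 0 P * (pderiv 2 P * pderiv 1 (pderiv 2 P)) +
      pderiv 1 P * (pderiv 2 P * pderiv 0 (pderiv 2 P)))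
    + pderiv 0 P * (pderiv 1 P * pderiv 2 (pderiv 2 P)))

noncomputable def Uss (P : MvPolynomial (Fin 3) F) : MvPolynomial (Fin 3) F :=
  -(pderiv 0 (pderiv 0 P) * (pderiv 2 P * pderiv 2 P)
    - (pderiv 0 P * (pderiv 2 P * pderiv 0 (pderiv 2 P)) +
      pderiv 0 P * (pderiv 2 P * pderiv 0 (pderiv 2 P)))
    + pderiv 0 P * (pderiv 0 P * pderiv 2 (pderiv 2 P)))

noncomputable def E1 (P : MvPolynomial (Fin 3) F) : MvPolynomial (Fin 3) F :=
  pderiv 2 P * Ust P + pderiv 2 P * Ust P - pderiv 1 P * Utt P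

noncomputable def E0 (P : MvPolynomial (Fin 3) F) : MvPolynomial (Fin 3) F :=
  pderiv 2 P * Uss P - pderiv 0 P * Utt P

noncomputable def disc (P : MvPolynomial (Fin 3) F) : MvPolynomial (Fin 3) F :=
  pderiv 1 P * pderiv 1 P - MvPolynomial.C 4 * (pderiv 0 P * pderiv 2 P)

theorem pde_I1 {K : Type*} [Field K] (φ : MvPolynomial (Fin 3) F →+* K)
    (P : MvPolynomial (Fin 3) F) (α : K) (hE1 : φ (E1 P) = 0)
    (h1 : φ (pderiv 0 P) + α * φ (pderiv 1 P) + α ^ 2 * φ (pderiv 2 P) = 0)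
    (hu : φ (pderiv 2 P) ≠ 0) :
    2 * φ (pderiv 2 P) ^ 2 *
      ((φ (pderiv 0 (pderiv 2 P)) + α * φ (pderiv 1 (pderiv 2 P))
        + α ^ 2 * φ (pderiv 2 (pderiv 2 P))) * (φ (pderiv 1 P) + 2 * α * φ (pderiv 2 P))
      - φ (pderiv 2 P) * ((φ (pderiv 0 (pderiv 1 P)) + α * φ (pderiv 1 (pderiv 1 P))
        + α ^ 2 * φ (pderiv 1 (pderiv 2 P))) + 2 * α *
          (φ (pderiv 0 (pderiv 2 P)) + α * φ (pderiv 1 (pderiv 2 P))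
        + α ^ 2 * φ (pderiv 2 (pderiv 2 P)))))
      = φ (Utt P) * (φ (pderiv 1 P) + 2 * α * φ (pderiv 2 P)) := by
  simp only [E1, Utt, Ust, map_add, map_sub, map_mul, map_neg] at hE1 ⊢
  generalize φ (pderiv 0 P) = ps at *
  generalize φ (pderiv 1 P) = pt at *
  generalize φ (pderiv 2 P) = pu at *
  generalize φ (pderiv 0 (pderiv 1 P)) = pst at *
  generalize φ (pderiv 1 (pderiv 1 P)) = ptt at *
  generalize φ (pderiv 1 (pderiv 2 P)) = ptu at *
  generalize φ (pderiv 0 (pderiv 2 P)) = psu at *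
  generalize φ (pderiv 2 (pderiv 2 P)) = puu at *
  obtain ⟨ut, rfl⟩ : ∃ ut, pt = -(ut * pu) := ⟨-pt / pu, by field_simp⟩
  obtain ⟨us, rfl⟩ : ∃ us, ps = -(us * pu) := ⟨-ps / pu, by field_simp⟩
  have h1' : us = α ^ 2 - α * ut := by
    apply mul_left_cancel₀ hu
    linear_combination -h1
  subst h1'
  obtain ⟨utt, rfl⟩ : ∃ utt, ptt = -(utt * pu + 2 * ut * ptu + ut ^ 2 * puu) :=
    ⟨-(ptt + 2 * ut * ptu + ut ^ 2 * puu) / pu, by field_simp; ring⟩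
  obtain ⟨ust, rfl⟩ : ∃ ust, pst = -(ust * pu + (α ^ 2 - α * ut) * ptu + ut * psu
      + (α ^ 2 - α * ut) * ut * puu) :=
    ⟨-(pst + (α ^ 2 - α * ut) * ptu + ut * psu + (α ^ 2 - α * ut) * ut * puu) / pu,
      by field_simp; ring⟩
  have e1 : 2 * ust + ut * utt = 0 := by
    apply mul_left_cancel₀ (pow_ne_zero 4 hu)
    linear_combination hE1
  linear_combination (pu ^ 4) * e1

set_option maxHeartbeats 4000000 in
theorem pde_I2 {K : Type*} [Field K] (h2 : (2:K) ≠ 0) (φ : MvPolynomial (Fin 3) F →+* K)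
    (P : MvPolynomial (Fin 3) F) (α : K) (hE1 : φ (E1 P) = 0) (hE0 : φ (E0 P) = 0)
    (hXE1 : φ (pderiv 2 P * pderiv 0 (E1 P) - pderiv 0 P * pderiv 2 (E1 P)) = 0)
    (hTE1 : φ (pderiv 2 P * pderiv 1 (E1 P) - pderiv 1 P * pderiv 2 (E1 P)) = 0)
    (hTE0 : φ (pderiv 2 P * pderiv 1 (E0 P) - pderiv 1 P * pderiv 2 (E0 P)) = 0)
    (h1 : φ (pderiv 0 P) + α * φ (pderiv 1 P) + α ^ 2 * φ (pderiv 2 P) = 0)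
    (hu : φ (pderiv 2 P) ≠ 0)
    (hd : φ (pderiv 1 P) + 2 * α * φ (pderiv 2 P) ≠ 0) :
    2 * φ (pderiv 2 P) ^ 2 *
      ((φ (pderiv 0 (Utt P)) + α * φ (pderiv 1 (Utt P)) + α ^ 2 * φ (pderiv 2 (Utt P)))
        * φ (pderiv 2 P)
      - 3 * φ (Utt P) * (φ (pderiv 0 (pderiv 2 P)) + α * φ (pderiv 1 (pderiv 2 P))
        + α ^ 2 * φ (pderiv 2 (pderiv 2 P))))
      = - φ (Utt P) ^ 2 := by
  simp only [E1, E0, Utt, Ust, Uss, map_add, map_sub, map_mul, map_neg,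
    MvPolynomial.pderiv_mul, pderiv_comm 1 0, pderiv_comm 2 0, pderiv_comm 2 1]
    at hE1 hE0 hXE1 hTE1 hTE0 ⊢
  generalize φ (pderiv 0 P) = ps at *
  generalize φ (pderiv 1 P) = pt at *
  generalize φ (pderiv 2 P) = pu at *
  generalize φ (pderiv 0 (pderiv 0 P)) = pss at *
  generalize φ (pderiv 0 (pderiv 1 P)) = pst at *
  generalize φ (pderiv 1 (pderiv 1 P)) = ptt at *
  generalize φ (pderiv 1 (pderiv 2 P)) = ptu at *
  generalize φ (pderiv 0 (pderiv 2 P)) = psu at *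
  generalize φ (pderiv 2 (pderiv 2 P)) = puu at *
  generalize φ (pderiv 0 (pderiv 0 (pderiv 1 P))) = psst at *
  generalize φ (pderiv 0 (pderiv 0 (pderiv 2 P))) = pssu at *
  generalize φ (pderiv 0 (pderiv 1 (pderiv 1 P))) = pstt at *
  generalize φ (pderiv 0 (pderiv 1 (pderiv 2 P))) = pstu at *
  generalize φ (pderiv 0 (pderiv 2 (pderiv 2 P))) = psuu at *
  generalize φ (pderiv 1 (pderiv 1 (pderiv 1 P))) = pttt at *
  generalize φ (pderiv 1 (pderiv 1 (pderiv 2 P))) = pttu at *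
  generalize φ (pderiv 1 (pderiv 2 (pderiv 2 P))) = ptuu at *
  generalize φ (pderiv 2 (pderiv 2 (pderiv 2 P))) = puuu at *
  obtain ⟨ut, rfl⟩ : ∃ ut, pt = -(ut * pu) := ⟨-pt / pu, by field_simp⟩
  obtain ⟨us, rfl⟩ : ∃ us, ps = -(us * pu) := ⟨-ps / pu, by field_simp⟩
  have h1' : us = α ^ 2 - α * ut := by
    apply mul_left_cancel₀ hu
    linear_combination -h1
  have hd' : (2 * α - ut) ≠ 0 := by
    intro h
    apply hd
    linear_combination pu * h
  obtain ⟨utt, rfl⟩ : ∃ utt, ptt = -(utt * pu + 2 * ut * ptu + ut ^ 2 * puu) :=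
    ⟨-(ptt + 2 * ut * ptu + ut ^ 2 * puu) / pu, by field_simp; ring⟩
  obtain ⟨uss, rfl⟩ : ∃ uss, pss = -(uss * pu + 2 * us * psu + us ^ 2 * puu) :=
    ⟨-(pss + 2 * us * psu + us ^ 2 * puu) / pu, by field_simp; ring⟩
  obtain ⟨ust, rfl⟩ : ∃ ust, pst = -(ust * pu + us * ptu + ut * psu + us * ut * puu) :=
    ⟨-(pst + us * ptu + ut * psu + us * ut * puu) / pu, by field_simp; ring⟩
  have e1 : 2 * ust + ut * utt = 0 := by
    apply mul_left_cancel₀ (pow_ne_zero 4 hu)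
    linear_combination hE1
  have e0 : uss + us * utt = 0 := by
    apply mul_left_cancel₀ (pow_ne_zero 4 hu)
    linear_combination hE0
  obtain ⟨uttt, rfl⟩ : ∃ uttt, pttt = -(uttt * pu + 3 * utt * ptu + 3 * ut * utt * puu +
      3 * ut * pttu + 3 * ut ^ 2 * ptuu + ut ^ 3 * puuu) :=
    ⟨-(pttt + 3 * utt * ptu + 3 * ut * utt * puu +
      3 * ut * pttu + 3 * ut ^ 2 * ptuu + ut ^ 3 * puuu) / pu, by field_simp; ring⟩
  obtain ⟨ustt, rfl⟩ : ∃ ustt, pstt = -(ustt * pu + (utt * psu + 2 * ust * ptu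
      + (us * utt + 2 * ut * ust) * puu + us * pttu + 2 * ut * pstu + ut ^ 2 * psuu
      + 2 * us * ut * ptuu + us * ut ^ 2 * puuu)) :=
    ⟨-(pstt + (utt * psu + 2 * ust * ptu
      + (us * utt + 2 * ut * ust) * puu + us * pttu + 2 * ut * pstu + ut ^ 2 * psuu
      + 2 * us * ut * ptuu + us * ut ^ 2 * puuu)) / pu, by field_simp; ring⟩
  obtain ⟨usst, rfl⟩ : ∃ usst, psst = -(usst * pu + (uss * ptu + 2 * ust * psu
      + (ut * uss + 2 * us * ust) * puu + ut * pssu + 2 * us * pstu + us ^ 2 * ptuu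
      + 2 * us * ut * psuu + ut * us ^ 2 * puuu)) :=
    ⟨-(psst + (uss * ptu + 2 * ust * psu
      + (ut * uss + 2 * us * ust) * puu + ut * pssu + 2 * us * pstu + us ^ 2 * ptuu
      + 2 * us * ut * psuu + ut * us ^ 2 * puuu)) / pu, by field_simp; ring⟩
  obtain rfl : uss = - (us * utt) := by linear_combination e0
  obtain ⟨w, rfl⟩ : ∃ w, utt = 2 * w := ⟨utt / 2, by field_simp⟩
  obtain rfl : ust = - (ut * w) := by
    apply mul_left_cancel₀ h2
    linear_combination e1
  have c1 : 2 * usst + (-(ut * w)) * (2 * w) + ut * ustt = 0 := by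
    apply mul_left_cancel₀ (pow_ne_zero 5 hu)
    linear_combination hXE1
  have c2 : 2 * ustt + (2 * w) ^ 2 + ut * uttt = 0 := by
    apply mul_left_cancel₀ (pow_ne_zero 5 hu)
    linear_combination hTE1
  have c3 : usst + (-(ut * w)) * (2 * w) + us * uttt = 0 := by
    apply mul_left_cancel₀ (pow_ne_zero 5 hu)
    linear_combination hTE0
  have c4 : uttt = 0 := by
    apply mul_left_cancel₀ (pow_ne_zero 2 hd')
    rw [h1'] at c3
    linear_combination (-2) * c1 + 4 * c3 + ut * c2
  subst c4
  have c5 : ustt = - 2 * w ^ 2 := by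
    apply mul_left_cancel₀ h2
    linear_combination c2
  subst c5
  subst h1'
  ring
end
end Rud

namespace Rud
section
variable {F : Type*} [Field F]
open MvPolynomial (pderiv)
open Classical

noncomputable def nb (R : Finset (F × F × F)) (b : F × F × F) : ℕ :=
  (R.filter (fun r => inc r b)).card

def cr (r b : F × F × F) : F := (b.2.1 - r.2.1) / (r.1 - b.1)

theorem inc_symm {r b : F × F × F} (h : inc r b) : inc b r := by
  unfold inc at *
  linear_combination -h

theorem pt_cr {r b : F × F × F} (h : inc r b) (hα : r.1 ≠ b.1) : pt r (cr r b) = pt b (cr r b) := by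
  have h0 : (r.1 - b.1) ≠ 0 := sub_ne_zero.2 hα
  have h1 : (r.1 - b.1) * cr r b = b.2.1 - r.2.1 := by
    unfold cr; field_simp
  unfold inc at h
  unfold pt
  have e1 : r.1 * cr r b + r.2.1 = b.1 * cr r b + b.2.1 := by linear_combination h1
  have e2 : r.1 ^ 2 * cr r b + (r.1 * r.2.1 + r.2.2) = b.1 ^ 2 * cr r b + (b.1 * b.2.1 + b.2.2) := by
    linear_combination h + (r.1 + b.1) * h1
  rw [e1, e2]

theorem inc_of_pt {r b : F × F × F} {s : F} (h : pt r s = pt b s) : inc r b := by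
  have h1 : r.1 * s + r.2.1 = b.1 * s + b.2.1 := congrFun h 1
  have h2 : r.1 ^ 2 * s + (r.1 * r.2.1 + r.2.2) = b.1 ^ 2 * s + (b.1 * b.2.1 + b.2.2) := congrFun h 2
  unfold inc
  linear_combination h2 - (r.1 + b.1) * h1

/-- counting crossings on a blue line -/
theorem count_cross (R T : Finset (F × F × F)) (b : F × F × F)
    (hsk : ∀ r ∈ R, ∀ r' ∈ R, r ≠ r' → ¬ inc r r') (hT : T ⊆ R)
    (hα : ∀ r ∈ R, r.1 ≠ b.1) (Q : MvPolynomial (Fin 3) F) (hQ : res b Q ≠ 0)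
    (h : ∀ r ∈ T, inc r b ∧ MvPolynomial.eval (pt b (cr r b)) Q = 0) :
    T.card ≤ Q.totalDegree := by
  have hinj : Set.InjOn (fun r => cr r b) T := by
    intro r hr r' hr' hrr
    by_contra hne
    simp only at hrr
    apply hsk r (hT hr) r' (hT hr') hne
    apply inc_of_pt (s := cr r b)
    rw [pt_cr (h r hr).1 (hα r (hT hr)), hrr, pt_cr (h r' hr').1 (hα r' (hT hr'))]
  rw [← Finset.card_image_of_injOn hinj]
  have hsub : T.image (fun r => cr r b) ⊆ (res b Q).roots.toFinset := by
    intro s hs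
    obtain ⟨r, hr, rfl⟩ := Finset.mem_image.1 hs
    rw [Multiset.mem_toFinset, Polynomial.mem_roots hQ, Polynomial.IsRoot, eval_res]
    exact (h r hr).2
  calc _ ≤ _ := Finset.card_le_card hsub
    _ ≤ _ := Multiset.toFinset_card_le _
    _ ≤ _ := Polynomial.card_roots' _
    _ ≤ _ := natDegree_res_le _ _

theorem first_order {l : F × F × F} {P : MvPolynomial (Fin 3) F} (h : res l P = 0) :
    res l (pderiv 0 P) + Polynomial.C l.1 * res l (pderiv 1 P)
      + Polynomial.C (l.1) ^ 2 * res l (pderiv 2 P) = 0 := by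
  have := derivative_res l P
  rw [h, Polynomial.derivative_zero, Polynomial.C_pow] at this
  exact this.symm

theorem first_order_ev {l : F × F × F} {P : MvPolynomial (Fin 3) F} (h : res l P = 0) (s : F) :
    MvPolynomial.eval (pt l s) (pderiv 0 P) + l.1 * MvPolynomial.eval (pt l s) (pderiv 1 P)
      + l.1 ^ 2 * MvPolynomial.eval (pt l s) (pderiv 2 P) = 0 := by
  have := congrArg (fun q => Polynomial.eval s q) (first_order h)
  simpa [eval_res] using this

theorem second_order_ev {l : F × F × F} {P : MvPolynomial (Fin 3) F} (h : res l P = 0) (s : F) :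
    let e := MvPolynomial.eval (pt l s)
    e (pderiv 0 (pderiv 0 P)) + 2 * l.1 * e (pderiv 0 (pderiv 1 P))
      + l.1 ^ 2 * (e (pderiv 1 (pderiv 1 P)) + 2 * e (pderiv 0 (pderiv 2 P)))
      + 2 * l.1 ^ 3 * e (pderiv 1 (pderiv 2 P)) + l.1 ^ 4 * e (pderiv 2 (pderiv 2 P)) = 0 := by
  intro e
  have h1 := congrArg (fun q => Polynomial.eval s (Polynomial.derivative q)) (first_order h)
  simp only [← Polynomial.C_pow] at h1
  simp only [Polynomial.derivative_add, Polynomial.derivative_C_mul, derivative_res,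
    Polynomial.eval_add, Polynomial.eval_mul, Polynomial.eval_C, eval_res,
    pderiv_comm 1 0, pderiv_comm 2 0, pderiv_comm 2 1, Polynomial.derivative_zero,
    Polynomial.eval_zero] at h1
  simp only [e]
  linear_combination h1

theorem cross_first {r b : F × F × F} {P : MvPolynomial (Fin 3) F} (hr : res r P = 0)
    (hb : res b P = 0) (hα : r.1 ≠ b.1) (hi : inc r b) :
    let e := MvPolynomial.eval (pt b (cr r b))
    e (pderiv 1 P) = -(r.1 + b.1) * e (pderiv 2 P) ∧ e (pderiv 0 P) = r.1 * b.1 * e (pderiv 2 P) := by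
  intro e
  have h1 := first_order_ev hr (cr r b)
  have h2 := first_order_ev hb (cr r b)
  rw [pt_cr hi hα] at h1
  change e _ + _ * e _ + _ * e _ = 0 at h1 h2
  have h0 : (r.1 - b.1) ≠ 0 := sub_ne_zero.2 hα
  constructor
  · apply mul_left_cancel₀ h0
    linear_combination h1 - h2
  · apply mul_left_cancel₀ h0
    linear_combination r.1 * h2 - b.1 * h1

theorem cross_second {r b : F × F × F} {P : MvPolynomial (Fin 3) F} (hr : res r P = 0)
    (hb : res b P = 0) (hα : r.1 ≠ b.1) (hi : inc r b) :
    let e := MvPolynomial.eval (pt b (cr r b))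
    e (E1 P) = 0 ∧ e (E0 P) = 0 := by
  intro e
  have h1 := second_order_ev hr (cr r b)
  have h2 := second_order_ev hb (cr r b)
  obtain ⟨h3, h4⟩ := cross_first hr hb hα hi
  simp only at h1 h2
  rw [pt_cr hi hα] at h1
  simp only [E1, E0, Utt, Ust, Uss, map_add, map_sub, map_mul, map_neg, e]
  rw [h3, h4]
  have h0 : (r.1 - b.1) ≠ 0 := sub_ne_zero.2 hα
  set e' := MvPolynomial.eval (pt b (cr r b))
  constructor
  · apply mul_left_cancel₀ h0
    linear_combination (-(e' (pderiv 2 P)) ^ 3) * (h1 - h2)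
  · apply mul_left_cancel₀ h0
    linear_combination (-(e' (pderiv 2 P)) ^ 3) * (r.1 * h2 - b.1 * h1)

theorem deg_mul_le {P Q : MvPolynomial (Fin 3) F} {a b c : ℕ} (hP : P.totalDegree ≤ a)
    (hQ : Q.totalDegree ≤ b) (h : a + b ≤ c) : (P * Q).totalDegree ≤ c :=
  (MvPolynomial.totalDegree_mul _ _).trans (by omega)
theorem deg_add_le {P Q : MvPolynomial (Fin 3) F} {c : ℕ} (hP : P.totalDegree ≤ c)
    (hQ : Q.totalDegree ≤ c) : (P + Q).totalDegree ≤ c :=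
  (MvPolynomial.totalDegree_add _ _).trans (max_le hP hQ)
theorem deg_sub_le {P Q : MvPolynomial (Fin 3) F} {c : ℕ} (hP : P.totalDegree ≤ c)
    (hQ : Q.totalDegree ≤ c) : (P - Q).totalDegree ≤ c :=
  (MvPolynomial.totalDegree_sub _ _).trans (max_le hP hQ)

theorem deg_pd (i : Fin 3) {P : MvPolynomial (Fin 3) F} {D : ℕ} (h : P.totalDegree ≤ D) :
    (pderiv i P).totalDegree ≤ D := (totalDegree_pderiv_le i P).trans (by omega)

theorem deg_U {A B C P1 P2 P3 P4 : MvPolynomial (Fin 3) F} {D : ℕ} (hA : A.totalDegree ≤ D)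
    (hB : B.totalDegree ≤ D) (hC : C.totalDegree ≤ D) (h1 : P1.totalDegree ≤ D)
    (h2 : P2.totalDegree ≤ D) (h3 : P3.totalDegree ≤ D) (h4 : P4.totalDegree ≤ D) :
    (-(A * (P3 * P3) - (P1 * (P3 * B) + P2 * (P3 * P4)) + P1 * (P2 * C))).totalDegree ≤ 3 * D := by
  rw [MvPolynomial.totalDegree_neg]
  have t : ∀ X Y Z : MvPolynomial (Fin 3) F, X.totalDegree ≤ D → Y.totalDegree ≤ D →
      Z.totalDegree ≤ D → (X * (Y * Z)).totalDegree ≤ 3 * D := by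
    intro X Y Z hX hY hZ
    exact deg_mul_le hX (deg_mul_le hY hZ le_rfl) (by omega)
  exact deg_add_le (deg_sub_le (t _ _ _ hA h3 h3) (deg_add_le (t _ _ _ h1 h3 hB) (t _ _ _ h2 h3 h4)))
    (t _ _ _ h1 h2 hC)

theorem deg_Utt (P : MvPolynomial (Fin 3) F) : (Utt P).totalDegree ≤ 3 * P.totalDegree := by
  unfold Utt
  apply deg_U <;> (repeat' apply deg_pd) <;> exact le_rfl

theorem deg_Ust (P : MvPolynomial (Fin 3) F) : (Ust P).totalDegree ≤ 3 * P.totalDegree := by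
  unfold Ust
  apply deg_U <;> (repeat' apply deg_pd) <;> exact le_rfl

theorem deg_Uss (P : MvPolynomial (Fin 3) F) : (Uss P).totalDegree ≤ 3 * P.totalDegree := by
  unfold Uss
  apply deg_U <;> (repeat' apply deg_pd) <;> exact le_rfl

theorem deg_E1 (P : MvPolynomial (Fin 3) F) : (E1 P).totalDegree ≤ 4 * P.totalDegree := by
  have h1 := deg_pd 2 (le_refl P.totalDegree)
  have h2 := deg_pd 1 (le_refl P.totalDegree)
  unfold E1
  exact deg_sub_le (deg_add_le (deg_mul_le h1 (deg_Ust P) (by omega))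
    (deg_mul_le h1 (deg_Ust P) (by omega))) (deg_mul_le h2 (deg_Utt P) (by omega))

theorem deg_E0 (P : MvPolynomial (Fin 3) F) : (E0 P).totalDegree ≤ 4 * P.totalDegree := by
  have h1 := deg_pd 2 (le_refl P.totalDegree)
  have h2 := deg_pd 0 (le_refl P.totalDegree)
  unfold E0
  exact deg_sub_le (deg_mul_le h1 (deg_Uss P) (by omega)) (deg_mul_le h2 (deg_Utt P) (by omega))

theorem deg_disc (P : MvPolynomial (Fin 3) F) : (disc P).totalDegree ≤ 2 * P.totalDegree := by
  have h0 := deg_pd 0 (le_refl P.totalDegree)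
  have h1 := deg_pd 1 (le_refl P.totalDegree)
  have h2 := deg_pd 2 (le_refl P.totalDegree)
  unfold disc
  exact deg_sub_le (deg_mul_le h1 h1 (by omega))
    (deg_mul_le (a := 0) (by simp) (deg_mul_le h0 h2 le_rfl) (by omega))

/-- the test polynomial argument -/
theorem test_case (P : MvPolynomial (Fin 3) F) (hP : Irreducible P) (R Bl : Finset (F × F × F))
    (hsk : ∀ r ∈ R, ∀ r' ∈ R, r ≠ r' → ¬ inc r r')
    (hZ : ∀ r ∈ R, res r P = 0) (hα : ∀ r ∈ R, ∀ b ∈ Bl, r.1 ≠ b.1)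
    (Q : MvPolynomial (Fin 3) F) (e : ℕ) (hQ : ¬ P ∣ Q) (he : Q.totalDegree ≤ e)
    (hDe : P.totalDegree ≤ e)
    (h : ∀ b ∈ Bl, res b P = 0 → ∀ r ∈ R, inc r b → MvPolynomial.eval (pt b (cr r b)) Q = 0) :
    ∃ Bad ⊆ Bl, Bad.card ≤ P.totalDegree * e ∧ ∀ b ∈ Bl, b ∉ Bad → nb R b ≤ e := by
  refine ⟨Bl.filter (fun b => res b P = 0 ∧ res b Q = 0), Finset.filter_subset _ _, ?_, ?_⟩
  · refine (bezout P Q hP hQ _ ?_ ?_).trans (Nat.mul_le_mul_left _ he)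
    · intro l hl; exact (Finset.mem_filter.1 hl).2.1
    · intro l hl; exact (Finset.mem_filter.1 hl).2.2
  · intro b hb hbad
    unfold nb
    by_cases hbP : res b P = 0
    · have hbQ : res b Q ≠ 0 := fun hq => hbad (Finset.mem_filter.2 ⟨hb, hbP, hq⟩)
      refine (count_cross R _ b hsk (Finset.filter_subset _ _) (fun r hr => hα r hr b hb) Q hbQ ?_).trans he
      intro r hr
      obtain ⟨hr, hi⟩ := Finset.mem_filter.1 hr
      exact ⟨hi, h b hb hbP r hr hi⟩
    · refine (count_cross R _ b hsk (Finset.filter_subset _ _) (fun r hr => hα r hr b hb) P hbP ?_).trans hDe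
      intro r hr
      obtain ⟨hr, hi⟩ := Finset.mem_filter.1 hr
      refine ⟨hi, ?_⟩
      rw [← pt_cr hi (hα r hr b hb), ← eval_res, hZ r hr, Polynomial.eval_zero]

theorem not_dvd_of_deg {P Q : MvPolynomial (Fin 3) F} (hQ : Q ≠ 0)
    (h : Q.totalDegree < P.totalDegree) : ¬ P ∣ Q := by
  rintro ⟨c, rfl⟩
  have hP : P ≠ 0 := left_ne_zero_of_mul hQ
  have hc : c ≠ 0 := right_ne_zero_of_mul hQ
  rw [MvPolynomial.totalDegree_mul_of_isDomain hP hc] at h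
  omega

theorem irr_deg_pos {P : MvPolynomial (Fin 3) F} (hP : Irreducible P) : 0 < P.totalDegree := by
  rw [Nat.pos_iff_ne_zero]
  intro h
  rw [MvPolynomial.totalDegree_eq_zero_iff_eq_C] at h
  have h1 : P.coeff 0 ≠ 0 := by
    intro h0
    rw [h0, map_zero] at h
    exact hP.ne_zero h
  apply hP.not_isUnit
  rw [h]
  exact (isUnit_iff_ne_zero.2 h1).map MvPolynomial.C
end
end Rud

namespace Rud
section
variable {F : Type*} [Field F]
open MvPolynomial (pderiv)
open Classical

theorem tang_zero {P E : MvPolynomial (Fin 3) F} {b : F × F × F} (hb : res b P = 0) (h : P ∣ E)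
    (i j : Fin 3) : res b (pderiv i P * pderiv j E - pderiv j P * pderiv i E) = 0 := by
  obtain ⟨H, rfl⟩ := h
  simp only [MvPolynomial.pderiv_mul, map_sub, map_mul, map_add, hb]
  ring

theorem res_of_dvd {P E : MvPolynomial (Fin 3) F} {b : F × F × F} (hb : res b P = 0) (h : P ∣ E) :
    res b E = 0 := by
  obtain ⟨H, rfl⟩ := h
  rw [map_mul, hb, zero_mul]

theorem res_disc {P : MvPolynomial (Fin 3) F} {b : F × F × F} (hb : res b P = 0) :
    res b (disc P) = (res b (pderiv 1 P) + 2 * Polynomial.C b.1 * res b (pderiv 2 P)) ^ 2 := by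
  have h1 := first_order hb
  have h4 : res b (MvPolynomial.C (4:F)) = 4 := by
    rw [map_ofNat MvPolynomial.C 4, map_ofNat]
  unfold disc
  rw [map_sub, map_mul, map_mul, map_mul, h4]
  linear_combination (-4 * res b (pderiv 2 P)) * h1

theorem key_lin {p : ℕ} [CharP F p] (h2 : (2:F) ≠ 0) (P : MvPolynomial (Fin 3) F)
    (hD1 : 1 ≤ P.totalDegree)
    (hDp : 4 * P.totalDegree < p) (b : F × F × F) (hb : res b P = 0) (hE1 : P ∣ E1 P)
    (hE0 : P ∣ E0 P) (hu : res b (pderiv 2 P) ≠ 0) (hdisc : res b (disc P) ≠ 0) :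
    ∃ c0 c : F, res b (pderiv 2 P) = (Polynomial.C c0 + Polynomial.C c * Polynomial.X) *
      (res b (pderiv 1 P) + 2 * Polynomial.C b.1 * res b (pderiv 2 P)) := by
  have hd : res b (pderiv 1 P) + 2 * Polynomial.C b.1 * res b (pderiv 2 P) ≠ 0 := by
    intro h
    apply hdisc
    rw [res_disc hb, h]; simp
  let K := FractionRing (Polynomial F)
  let ι : Polynomial F →+* K := algebraMap (Polynomial F) K
  have hι : Function.Injective ι := IsFractionRing.injective _ _
  let φ : MvPolynomial (Fin 3) F →+* K := ι.comp (res b).toRingHom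
  have hφ : ∀ Q, φ Q = ι (res b Q) := fun Q => rfl
  have hK2 : (2:K) ≠ 0 := by
    have : (2:K) = ι (Polynomial.C 2) := by
      rw [map_ofNat Polynomial.C 2, map_ofNat]
    rw [this]
    intro h
    rw [← map_zero ι] at h
    have := hι h
    rw [Polynomial.C_eq_zero] at this
    exact h2 this
  have z : ∀ Q, res b Q = 0 → φ Q = 0 := by
    intro Q hQ; rw [hφ, hQ, map_zero]
  have nz : ∀ q : Polynomial F, q ≠ 0 → ι q ≠ 0 := by
    intro q hq h
    rw [← map_zero ι] at h
    exact hq (hι h)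
  have f1 : φ (pderiv 0 P) + ι (Polynomial.C b.1) * φ (pderiv 1 P)
      + ι (Polynomial.C b.1) ^ 2 * φ (pderiv 2 P) = 0 := by
    have := congrArg ι (first_order hb)
    simpa [hφ] using this
  have d1 : φ (pderiv 1 P) + 2 * ι (Polynomial.C b.1) * φ (pderiv 2 P) ≠ 0 := by
    have := nz _ hd
    rw [map_add, map_mul, map_mul, map_ofNat] at this
    exact this
  have I1 := pde_I1 φ P (ι (Polynomial.C b.1)) (z _ (res_of_dvd hb hE1)) f1 (nz _ hu)
  have I2 := pde_I2 hK2 φ P (ι (Polynomial.C b.1)) (z _ (res_of_dvd hb hE1))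
    (z _ (res_of_dvd hb hE0)) (z _ (tang_zero hb hE1 2 0)) (z _ (tang_zero hb hE1 2 1))
    (z _ (tang_zero hb hE0 2 1)) f1 (nz _ hu) d1
  obtain ⟨h, hh⟩ : ∃ h, h = res b (pderiv 2 P) := ⟨_, rfl⟩
  obtain ⟨q, hq⟩ : ∃ q, q = res b (pderiv 1 P) := ⟨_, rfl⟩
  obtain ⟨U, hU⟩ : ∃ U, U = res b (Utt P) := ⟨_, rfl⟩
  have dh : Polynomial.derivative h = res b (pderiv 0 (pderiv 2 P)) +
      Polynomial.C b.1 * res b (pderiv 1 (pderiv 2 P)) +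
      Polynomial.C b.1 ^ 2 * res b (pderiv 2 (pderiv 2 P)) := by
    rw [hh, derivative_res, Polynomial.C_pow]
  have dq : Polynomial.derivative q = res b (pderiv 0 (pderiv 1 P)) +
      Polynomial.C b.1 * res b (pderiv 1 (pderiv 1 P)) +
      Polynomial.C b.1 ^ 2 * res b (pderiv 1 (pderiv 2 P)) := by
    rw [hq, derivative_res, Polynomial.C_pow, pderiv_comm 2 1]
  have dU : Polynomial.derivative U = res b (pderiv 0 (Utt P)) +
      Polynomial.C b.1 * res b (pderiv 1 (Utt P)) +
      Polynomial.C b.1 ^ 2 * res b (pderiv 2 (Utt P)) := by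
    rw [hU, derivative_res, Polynomial.C_pow]
  simp only [hφ] at I1 I2
  have J1 : 2 * h ^ 2 * (Polynomial.derivative h * (q + 2 * Polynomial.C b.1 * h)
      - h * (Polynomial.derivative q + 2 * Polynomial.C b.1 * Polynomial.derivative h))
      = U * (q + 2 * Polynomial.C b.1 * h) := by
    apply hι
    rw [dh, dq, hh, hq, hU]
    simp only [map_mul, map_add, map_sub, map_pow, map_ofNat]
    exact I1
  have J2 : 2 * h ^ 2 * (Polynomial.derivative U * h - 3 * U * Polynomial.derivative h) = - U ^ 2 := by
    apply hι
    rw [dh, dU, hh, hU]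
    simp only [map_mul, map_add, map_sub, map_pow, map_neg, map_ofNat]
    exact I2
  rw [← hh] at hu
  rw [← hh, ← hq] at hd ⊢
  obtain ⟨d, hdd⟩ : ∃ d, d = q + 2 * Polynomial.C b.1 * h := ⟨_, rfl⟩
  have hd2 : Polynomial.derivative d = Polynomial.derivative q + 2 * Polynomial.C b.1 * Polynomial.derivative h := by
    rw [hdd]
    have e2 : Polynomial.derivative (2 : Polynomial F) = 0 := by
      have : (2 : Polynomial F) = Polynomial.C 2 := (map_ofNat Polynomial.C 2).symm
      rw [this, Polynomial.derivative_C]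
    simp only [Polynomial.derivative_add, Polynomial.derivative_mul, e2, Polynomial.derivative_C]
    ring
  rw [← hdd] at J1 hd ⊢
  rw [← hd2] at J1
  have hdeg_h : h.natDegree ≤ P.totalDegree := by
    rw [hh]; exact (natDegree_res_le _ _).trans (deg_pd 2 le_rfl)
  have hdeg_q : q.natDegree ≤ P.totalDegree := by
    rw [hq]; exact (natDegree_res_le _ _).trans (deg_pd 1 le_rfl)
  have hdeg_d : d.natDegree ≤ P.totalDegree := by
    rw [hdd]
    refine (Polynomial.natDegree_add_le _ _).trans (max_le hdeg_q ?_)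
    refine le_trans ?_ hdeg_h
    have : 2 * Polynomial.C b.1 * h = Polynomial.C (2 * b.1) * h := by
      rw [map_mul, map_ofNat Polynomial.C 2]
    rw [this]
    exact Polynomial.natDegree_C_mul_le _ _
  obtain ⟨n, hn⟩ : ∃ n, n = Polynomial.derivative h * d - h * Polynomial.derivative d := ⟨_, rfl⟩
  rw [← hn] at J1
  have J1' := congrArg Polynomial.derivative J1
  have e2 : Polynomial.derivative (2 : Polynomial F) = 0 := by
    have : (2 : Polynomial F) = Polynomial.C 2 := (map_ofNat Polynomial.C 2).symm
    rw [this, Polynomial.derivative_C]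
  rw [pow_two] at J1'
  simp only [Polynomial.derivative_mul, e2] at J1'
  have hH2 : (4 : Polynomial F) ≠ 0 := by
    have : (4 : Polynomial F) = Polynomial.C (2*2) := by
      rw [map_mul, map_ofNat Polynomial.C 2]; norm_num
    rw [this, Ne, Polynomial.C_eq_zero]
    exact mul_ne_zero h2 h2
  have W : Polynomial.derivative n * d = 2 * n * Polynomial.derivative d := by
    apply mul_left_cancel₀ (mul_ne_zero hH2 (pow_ne_zero 5 hu))
    linear_combination (2 * h ^ 3 * d) * J1' + d ^ 2 * J2 +
      (-6 * h ^ 2 * Polynomial.derivative h * d - 2 * h ^ 3 * Polynomial.derivative d + U * d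
        + 2 * h ^ 2 * n) * J1 - 4 * h ^ 4 * n * hn
  have hdh : (Polynomial.derivative h).natDegree ≤ P.totalDegree :=
    (Polynomial.natDegree_derivative_le _).trans (by omega)
  have hdd' : (Polynomial.derivative d).natDegree ≤ P.totalDegree :=
    (Polynomial.natDegree_derivative_le _).trans (by omega)
  have hdn : n.natDegree ≤ 2 * P.totalDegree := by
    rw [hn]
    refine (Polynomial.natDegree_sub_le _ _).trans (max_le ?_ ?_)
    · exact Polynomial.natDegree_mul_le.trans (by omega)
    · exact Polynomial.natDegree_mul_le.trans (by omega)
  obtain ⟨c, hc⟩ := wronsk (p := p) n (d * d) (mul_ne_zero hd hd) (by omega)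
    (lt_of_le_of_lt Polynomial.natDegree_mul_le (by omega))
    (by rw [Polynomial.derivative_mul]; linear_combination d * W)
  obtain ⟨c0, hc0⟩ := wronsk (p := p) (h - Polynomial.C c * Polynomial.X * d) d hd
    (by
      have hx : (Polynomial.C c * Polynomial.X * d).natDegree ≤ P.totalDegree + 1 := by
        refine Polynomial.natDegree_mul_le.trans ?_
        have := (Polynomial.natDegree_C_mul_le c (Polynomial.X : Polynomial F)).trans Polynomial.natDegree_X_le
        omega
      have hy := Polynomial.natDegree_sub_le h (Polynomial.C c * Polynomial.X * d)
      have hz : max h.natDegree (Polynomial.C c * Polynomial.X * d).natDegree ≤ P.totalDegree + 1 :=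
        max_le (by omega) hx
      omega) (by omega)
    (by
      simp only [Polynomial.derivative_sub, Polynomial.derivative_mul, Polynomial.derivative_C,
        Polynomial.derivative_X]
      linear_combination hc - hn)
  refine ⟨c0, c, ?_⟩
  linear_combination hc0
end
end Rud

namespace Rud
section
variable {F : Type*} [Field F]
open MvPolynomial (pderiv)
open Classical

noncomputable def tH (b : F × F × F) : MvPolynomial (Fin 3) F :=
  MvPolynomial.X 1 - (MvPolynomial.C b.1 * MvPolynomial.X 0 + MvPolynomial.C b.2.1)

noncomputable def uH (b : F × F × F) : MvPolynomial (Fin 3) F :=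
  MvPolynomial.X 2 - (MvPolynomial.C b.1 * MvPolynomial.X 1 + MvPolynomial.C b.2.2)
    - MvPolynomial.C b.1 * tH b

noncomputable def quadric (b : F × F × F) (c0 c : F) : MvPolynomial (Fin 3) F :=
  MvPolynomial.C c0 * uH b + MvPolynomial.C c * (MvPolynomial.X 0 * uH b - tH b * tH b) + tH b

theorem deg_CX (a : F) (i : Fin 3) :
    (MvPolynomial.C a * MvPolynomial.X i : MvPolynomial (Fin 3) F).totalDegree ≤ 1 :=
  (MvPolynomial.totalDegree_mul _ _).trans (by simp)

theorem deg_tH (b : F × F × F) : (tH b).totalDegree ≤ 1 :=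
  deg_sub_le (by simp) (deg_add_le (deg_CX _ _) (by simp))

theorem deg_uH (b : F × F × F) : (uH b).totalDegree ≤ 1 :=
  deg_sub_le (deg_sub_le (by simp) (deg_add_le (deg_CX _ _) (by simp)))
    (deg_mul_le (a := 0) (b := 1) (by simp) (deg_tH b) le_rfl)

theorem deg_quadric (b : F × F × F) (c0 c : F) : (quadric b c0 c).totalDegree ≤ 2 := by
  refine deg_add_le (deg_add_le ?_ ?_) ((deg_tH b).trans (by omega))
  · exact deg_mul_le (a := 0) (b := 1) (by simp) (deg_uH b) (by omega)
  · refine deg_mul_le (a := 0) (b := 2) (by simp) ?_ (by omega)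
    exact deg_sub_le (deg_mul_le (a := 1) (b := 1) (by simp) (deg_uH b) (by omega))
      (deg_mul_le (deg_tH b) (deg_tH b) (by omega))

theorem quadric_ne_zero (h2 : (2:F) ≠ 0) (b : F × F × F) (c0 c : F) : quadric b c0 c ≠ 0 := by
  intro h
  have e1 := congrArg (MvPolynomial.eval ![0, 1 + b.2.1, b.1 * (1 + b.2.1) + b.2.2 + b.1]) h
  have e2 := congrArg (MvPolynomial.eval ![0, -1 + b.2.1, b.1 * (-1 + b.2.1) + b.2.2 - b.1]) h
  simp [quadric, uH, tH] at e1 e2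
  apply h2
  linear_combination e1 - e2

theorem quadric_contains (r b : F × F × F) (c0 c : F) (hi : inc r b) (hα : r.1 ≠ b.1)
    (h : (c0 + c * cr r b) * (b.1 - r.1) = 1) : res r (quadric b c0 c) = 0 := by
  have h0 : (r.1 - b.1) ≠ 0 := sub_ne_zero.2 hα
  have h1 : (r.1 - b.1) * cr r b = b.2.1 - r.2.1 := by
    unfold cr; field_simp
  unfold inc at hi
  generalize cr r b = s0 at *
  obtain ⟨α, β, η⟩ := r
  obtain ⟨a, β', η'⟩ := b
  simp only at *
  obtain rfl : β' = β + (α - a) * s0 := by linear_combination -h1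
  obtain rfl : η' = η - (β * a - (β + (α - a) * s0) * α) := by linear_combination -hi
  have h' := congrArg (Polynomial.C) h
  simp only [map_mul, map_add, map_sub, map_one] at h'
  simp only [quadric, uH, tH, res, map_mul, map_add, map_sub, MvPolynomial.aeval_X,
    MvPolynomial.aeval_C, Polynomial.algebraMap_eq]
  simp only [Matrix.cons_val_zero, Matrix.cons_val_one, Matrix.cons_val, 
    map_pow]
  linear_combination (- (Polynomial.C α - Polynomial.C a) * (Polynomial.X - Polynomial.C s0)) * h'

theorem case_main {p : ℕ} [CharP F p] (h2 : (2:F) ≠ 0) (P : MvPolynomial (Fin 3) F)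
    (hP : Irreducible P)
    (hDp : 4 * P.totalDegree < p) (R Bl : Finset (F × F × F))
    (hsk : ∀ r ∈ R, ∀ r' ∈ R, r ≠ r' → ¬ inc r r')
    (hZ : ∀ r ∈ R, res r P = 0) (hα : ∀ r ∈ R, ∀ b ∈ Bl, r.1 ≠ b.1) (hD3 : 3 ≤ P.totalDegree) :
    ∃ Bad ⊆ Bl, Bad.card ≤ 4 * P.totalDegree ^ 2 ∧
      ∀ b ∈ Bl, b ∉ Bad → nb R b ≤ 4 * P.totalDegree := by
  by_cases hE1 : P ∣ E1 P
  swap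
  · obtain ⟨Bad, h1, h2, h3⟩ := test_case P hP R Bl hsk hZ hα (E1 P) (4 * P.totalDegree) hE1
      (deg_E1 P) (by omega) (fun b hb hbP r hr hi =>
        (cross_second (hZ r hr) hbP (hα r hr b hb) hi).1)
    exact ⟨Bad, h1, h2.trans (by nlinarith), h3⟩
  by_cases hE0 : P ∣ E0 P
  swap
  · obtain ⟨Bad, h1, h2, h3⟩ := test_case P hP R Bl hsk hZ hα (E0 P) (4 * P.totalDegree) hE0
      (deg_E0 P) (by omega) (fun b hb hbP r hr hi =>
        (cross_second (hZ r hr) hbP (hα r hr b hb) hi).2)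
    exact ⟨Bad, h1, h2.trans (by nlinarith), h3⟩
  have hnd : ∀ i, pderiv i P ≠ 0 → ¬ P ∣ pderiv i P := by
    intro i hi
    apply not_dvd_of_deg hi
    have := totalDegree_pderiv_le i P
    omega
  have test1 : ∀ i, pderiv i P ≠ 0 → (∀ b ∈ Bl, res b P = 0 → ∀ r ∈ R, inc r b →
      MvPolynomial.eval (pt b (cr r b)) (pderiv i P) = 0) → ∃ Bad ⊆ Bl,
      Bad.card ≤ 4 * P.totalDegree ^ 2 ∧
      ∀ b ∈ Bl, b ∉ Bad → nb R b ≤ 4 * P.totalDegree := by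
    intro i hi h
    obtain ⟨Bad, h1, h2, h3⟩ := test_case P hP R Bl hsk hZ hα (pderiv i P) (P.totalDegree)
      (hnd i hi) (deg_pd i le_rfl) le_rfl h
    exact ⟨Bad, h1, h2.trans (by nlinarith), fun b hb hbad => (h3 b hb hbad).trans (by omega)⟩
  by_cases hu : pderiv 2 P = 0
  · by_cases ht : pderiv 1 P = 0
    · by_cases hs : pderiv 0 P = 0
      · have := eq_C_of_pderiv_zero (p := p) P (by omega) (by
          intro i; fin_cases i
          · exact hs
          · exact ht
          · exact hu)
        omega
      · apply test1 0 hs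
        intro b hb hbP r hr hi
        have := (cross_first (hZ r hr) hbP (hα r hr b hb) hi).2
        rw [this, hu]; simp
    · apply test1 1 ht
      intro b hb hbP r hr hi
      have := (cross_first (hZ r hr) hbP (hα r hr b hb) hi).1
      rw [this, hu]; simp
  by_cases hdisc : P ∣ disc P
  · apply test1 2 hu
    intro b hb hbP r hr hi
    obtain ⟨e1, e2⟩ := cross_first (hZ r hr) hbP (hα r hr b hb) hi
    have h3 := res_of_dvd hbP hdisc
    have h4 : MvPolynomial.eval (pt b (cr r b)) (disc P) = 0 := by
      rw [← eval_res, h3, Polynomial.eval_zero]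
    simp only [disc, map_sub, map_mul, MvPolynomial.eval_C] at h4
    rw [e1, e2] at h4
    have h0 : (r.1 - b.1) ≠ 0 := sub_ne_zero.2 (hα r hr b hb)
    have h5 : ((r.1 - b.1) * MvPolynomial.eval (pt b (cr r b)) (pderiv 2 P)) ^ 2 = 0 := by
      linear_combination h4
    exact (mul_eq_zero.1 (pow_eq_zero_iff (by norm_num) |>.1 h5)).resolve_left h0
  refine ⟨Bl.filter (fun b => res b P = 0 ∧ res b (pderiv 2 P) = 0) ∪
    Bl.filter (fun b => res b P = 0 ∧ res b (disc P) = 0),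
    Finset.union_subset (Finset.filter_subset _ _) (Finset.filter_subset _ _), ?_, ?_⟩
  · have b1 := bezout P (pderiv 2 P) hP (hnd 2 hu)
      (Bl.filter (fun b => res b P = 0 ∧ res b (pderiv 2 P) = 0))
      (fun l hl => (Finset.mem_filter.1 hl).2.1) (fun l hl => (Finset.mem_filter.1 hl).2.2)
    have b2 := bezout P (disc P) hP hdisc
      (Bl.filter (fun b => res b P = 0 ∧ res b (disc P) = 0))
      (fun l hl => (Finset.mem_filter.1 hl).2.1) (fun l hl => (Finset.mem_filter.1 hl).2.2)
    have c1 := Nat.mul_le_mul_left P.totalDegree (deg_pd 2 (le_refl P.totalDegree))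
    have c2 := Nat.mul_le_mul_left P.totalDegree (deg_disc P)
    refine (Finset.card_union_le _ _).trans ?_
    nlinarith
  · intro b hb hbad
    unfold nb
    by_cases hbP : res b P = 0
    swap
    · refine (count_cross R _ b hsk (Finset.filter_subset _ _) (fun r hr => hα r hr b hb) P hbP
        ?_).trans (by omega)
      intro r hr
      obtain ⟨hr, hi⟩ := Finset.mem_filter.1 hr
      refine ⟨hi, ?_⟩
      rw [← pt_cr hi (hα r hr b hb), ← eval_res, hZ r hr, Polynomial.eval_zero]
    have hub : res b (pderiv 2 P) ≠ 0 := fun h => hbad (Finset.mem_union_left _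
      (Finset.mem_filter.2 ⟨hb, hbP, h⟩))
    have hdb : res b (disc P) ≠ 0 := fun h => hbad (Finset.mem_union_right _
      (Finset.mem_filter.2 ⟨hb, hbP, h⟩))
    obtain ⟨c0, c, hc⟩ := key_lin (p := p) h2 P (by omega) hDp b hbP hE1 hE0 hub hdb
    set T := R.filter (fun r => inc r b) with hT
    have n1 : (T.filter (fun r => MvPolynomial.eval (pt b (cr r b)) (pderiv 2 P) = 0)).card
        ≤ P.totalDegree := by
      refine (count_cross R _ b hsk ((Finset.filter_subset _ _).trans (Finset.filter_subset _ _))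
        (fun r hr => hα r hr b hb) (pderiv 2 P) hub ?_).trans (deg_pd 2 le_rfl)
      intro r hr
      obtain ⟨hr, he⟩ := Finset.mem_filter.1 hr
      exact ⟨(Finset.mem_filter.1 hr).2, he⟩
    have n2 : (T.filter (fun r => ¬ MvPolynomial.eval (pt b (cr r b)) (pderiv 2 P) = 0)).card
        ≤ P.totalDegree * 2 := by
      have hq : ¬ P ∣ quadric b c0 c := by
        apply not_dvd_of_deg (quadric_ne_zero h2 b c0 c)
        have := deg_quadric b c0 c
        omega
      refine (bezout P _ hP hq _ ?_ ?_).trans (Nat.mul_le_mul_left _ (deg_quadric b c0 c))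
      · intro r hr
        exact hZ r (Finset.mem_filter.1 (Finset.mem_filter.1 hr).1).1
      · intro r hr
        obtain ⟨hr, hne⟩ := Finset.mem_filter.1 hr
        obtain ⟨hr, hi⟩ := Finset.mem_filter.1 hr
        apply quadric_contains r b c0 c hi (hα r hr b hb)
        obtain ⟨e1, e2⟩ := cross_first (hZ r hr) hbP (hα r hr b hb) hi
        have h3 := congrArg (Polynomial.eval (cr r b)) hc
        simp only [Polynomial.eval_mul, Polynomial.eval_add, Polynomial.eval_C, Polynomial.eval_X,
          eval_res, Polynomial.eval_ofNat] at h3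
        rw [e1] at h3
        apply mul_right_cancel₀ hne
        linear_combination -h3
    have := Finset.card_filter_add_card_filter_not (s := T)
      (fun r => MvPolynomial.eval (pt b (cr r b)) (pderiv 2 P) = 0)
    omega
end
end Rud

namespace Rud
section
variable {F : Type*} [Field F]
open MvPolynomial (pderiv)
open Classical

theorem bilin (P : MvPolynomial (Fin 3) F) (hP : P.totalDegree ≤ 2) (A B C : Fin 3 → F) (x y : F) :
    MvPolynomial.eval (fun i => A i + x * B i + y * C i) P
      - MvPolynomial.eval (fun i => A i + x * B i) P
      - MvPolynomial.eval (fun i => A i + y * C i) P + MvPolynomial.eval A P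
    = x * y * (MvPolynomial.eval (fun i => A i + B i + C i) P
      - MvPolynomial.eval (fun i => A i + B i) P
      - MvPolynomial.eval (fun i => A i + C i) P + MvPolynomial.eval A P) := by
  simp only [MvPolynomial.eval_eq', Fin.prod_univ_three]
  simp only [← Finset.sum_sub_distrib, ← Finset.sum_add_distrib, Finset.mul_sum]
  apply Finset.sum_congr rfl
  intro m hm
  have h1 := (MvPolynomial.le_totalDegree hm).trans hP
  rw [Finsupp.sum_fintype _ _ (by simp), Fin.sum_univ_three] at h1
  generalize m 0 = i at *
  generalize m 1 = j at *
  generalize m 2 = k at *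
  have hi : i ≤ 2 := by omega
  have hj : j ≤ 2 := by omega
  have hk : k ≤ 2 := by omega
  interval_cases i <;> interval_cases j <;> interval_cases k <;>
    first
    | (exfalso; omega)
    | ring

theorem small_deg [Infinite F] (P : MvPolynomial (Fin 3) F) (hP : Irreducible P)
    (hD : P.totalDegree ≤ 2) (r1 r2 b : F × F × F) (h12 : ¬ inc r2 r1)
    (ha12 : r2.1 ≠ r1.1) (ha1 : r1.1 ≠ b.1) (ha2 : r2.1 ≠ b.1)
    (h1 : res r1 P = 0) (h2 : res r2 P = 0) (hb : res b P = 0) (hi : inc r1 b) : inc r2 b := by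
  obtain ⟨s0, hs0⟩ : ∃ s0, s0 = cr r1 b := ⟨_, rfl⟩
  have hz := pt_cr hi ha1
  rw [← hs0] at hz
  have n1 : r2.1 - r1.1 ≠ 0 := sub_ne_zero.2 ha12
  have n2 : r2.1 - b.1 ≠ 0 := sub_ne_zero.2 ha2
  have n3 : r1.1 - b.1 ≠ 0 := sub_ne_zero.2 ha1
  obtain ⟨t0, ht0⟩ : ∃ t0, t0 = b.1 * s0 + b.2.1 := ⟨_, rfl⟩
  obtain ⟨u0, hu0⟩ : ∃ u0, u0 = b.1 ^ 2 * s0 + (b.1 * b.2.1 + b.2.2) := ⟨_, rfl⟩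
  have ht1 : t0 = r1.1 * s0 + r1.2.1 := by rw [ht0]; exact (congrFun hz 1).symm
  have hu1 : u0 = r1.1 ^ 2 * s0 + (r1.1 * r1.2.1 + r1.2.2) := by rw [hu0]; exact (congrFun hz 2).symm
  let Z : Fin 3 → F := ![s0, t0, u0]
  let V1 : Fin 3 → F := ![1, r1.1, r1.1 ^ 2]
  let Vb : Fin 3 → F := ![1, b.1, b.1 ^ 2]
  have q1 : ∀ x, pt r1 (s0 + x) = fun i => Z i + x * V1 i := by
    intro x
    funext i
    fin_cases i
    · simp [pt, Z, V1]
    · simp [pt, Z, V1]; rw [ht1]; ring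
    · simp [pt, Z, V1]; rw [hu1]; ring
  have qb : ∀ x, pt b (s0 + x) = fun i => Z i + x * Vb i := by
    intro x
    funext i
    fin_cases i
    · simp [pt, Z, Vb]
    · simp [pt, Z, Vb]; rw [ht0]; ring
    · simp [pt, Z, Vb]; rw [hu0]; ring
  obtain ⟨A, hA⟩ : ∃ A, A = t0 - r2.2.1 - r2.1 * s0 := ⟨_, rfl⟩
  obtain ⟨B, hB⟩ : ∃ B, B = u0 - r2.2.2 - r2.1 * t0 := ⟨_, rfl⟩
  obtain ⟨x, hx⟩ : ∃ x, (r2.1 - r1.1) * (r1.1 - b.1) * x = B - b.1 * A :=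
    ⟨(B - b.1 * A) / ((r2.1 - r1.1) * (r1.1 - b.1)), by field_simp⟩
  obtain ⟨y, hy⟩ : ∃ y, (r2.1 - b.1) * (r1.1 - b.1) * y = r1.1 * A - B :=
    ⟨(r1.1 * A - B) / ((r2.1 - b.1) * (r1.1 - b.1)), by field_simp⟩
  have g1 : (r2.1 - r1.1) * x + (r2.1 - b.1) * y = A := by
    apply mul_left_cancel₀ n3
    linear_combination hx + hy
  have g2 : r1.1 * (r2.1 - r1.1) * x + b.1 * (r2.1 - b.1) * y = B := by
    apply mul_left_cancel₀ n3
    linear_combination r1.1 * hx + b.1 * hy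
  have q2 : pt r2 (s0 + x + y) = fun i => Z i + x * V1 i + y * Vb i := by
    funext i
    fin_cases i
    · simp [pt, Z, V1, Vb]
    · simp [pt, Z, V1, Vb]
      linear_combination g1 + hA
    · simp [pt, Z, V1, Vb]
      linear_combination r2.1 * (g1 + hA) + g2 + hB
  by_cases hx0 : x = 0
  · apply inc_of_pt (s := s0 + y)
    have : s0 + x + y = s0 + y := by rw [hx0]; ring
    rw [← this, q2, this, qb]
    simp [hx0]
  by_cases hy0 : y = 0
  · exfalso
    apply h12
    apply inc_of_pt (s := s0 + x)
    have : s0 + x + y = s0 + x := by rw [hy0]; ring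
    rw [← this, q2, this, q1]
    simp [hy0]
  exfalso
  have v1 : ∀ x, MvPolynomial.eval (fun i => Z i + x * V1 i) P = 0 := by
    intro x
    rw [← q1, ← eval_res, h1, Polynomial.eval_zero]
  have vb : ∀ x, MvPolynomial.eval (fun i => Z i + x * Vb i) P = 0 := by
    intro x
    rw [← qb, ← eval_res, hb, Polynomial.eval_zero]
  have vz : MvPolynomial.eval Z P = 0 := by
    have := v1 0
    simpa using this
  have v2 : MvPolynomial.eval (fun i => Z i + x * V1 i + y * Vb i) P = 0 := by
    rw [← q2, ← eval_res, h2, Polynomial.eval_zero]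
  have hc := bilin P hD Z V1 Vb x y
  rw [v1, vb, vz, v2] at hc
  have hc' := (mul_eq_zero.1 (by simpa using hc.symm)).resolve_left (mul_ne_zero hx0 hy0)
  have hall : ∀ x y, MvPolynomial.eval (fun i => Z i + x * V1 i + y * Vb i) P = 0 := by
    intro x y
    have hd := bilin P hD Z V1 Vb x y
    rw [v1, vb, vz] at hd
    simpa [hc'] using hd
  let L : MvPolynomial (Fin 3) F := MvPolynomial.X 2 - MvPolynomial.C (r1.1 + b.1) * MvPolynomial.X 1
    + MvPolynomial.C (r1.1 * b.1) * MvPolynomial.X 0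
    - MvPolynomial.C (u0 - (r1.1 + b.1) * t0 + r1.1 * b.1 * s0)
  have hLd : L.totalDegree ≤ 1 :=
    deg_sub_le (deg_add_le (deg_sub_le (by simp) (deg_CX _ _)) (deg_CX _ _)) (by rw [MvPolynomial.totalDegree_C]; omega)
  let ℓ : F → F × F × F := fun y => (r1.1, t0 + b.1 * y - r1.1 * (s0 + y),
    u0 + b.1 ^ 2 * y - r1.1 * (t0 + b.1 * y))
  have hℓ : Function.Injective ℓ := by
    intro y y' h
    have h' : t0 + b.1 * y - r1.1 * (s0 + y) = t0 + b.1 * y' - r1.1 * (s0 + y') :=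
      congrArg (fun q => q.2.1) h
    apply mul_left_cancel₀ n3
    linear_combination -h'
  have qℓ : ∀ x y, pt (ℓ y) (s0 + x + y) = fun i => Z i + x * V1 i + y * Vb i := by
    intro x y
    funext i
    fin_cases i
    · simp [pt, Z, V1, Vb]
    · simp [pt, Z, V1, Vb, ℓ]; ring
    · simp [pt, Z, V1, Vb, ℓ]; ring
  have hPL : P ∣ L := by
    by_contra hnd
    obtain ⟨S, hS⟩ := Infinite.exists_subset_card_eq F 3
    have := bezout P L hP hnd (S.image ℓ) (by
      intro l hl
      obtain ⟨y, -, rfl⟩ := Finset.mem_image.1 hl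
      apply Polynomial.funext
      intro s
      have e : s = s0 + (s - s0 - y) + y := by ring
      rw [eval_res, e, qℓ, hall, Polynomial.eval_zero]) (by
      intro l hl
      obtain ⟨y, -, rfl⟩ := Finset.mem_image.1 hl
      apply Polynomial.funext
      intro s
      have e : s = s0 + (s - s0 - y) + y := by ring
      rw [eval_res, e, qℓ, Polynomial.eval_zero]
      simp [L, Z, V1, Vb]
      ring)
    rw [Finset.card_image_of_injective _ hℓ, hS] at this
    have := Nat.mul_le_mul hD hLd
    omega
  have hL2 := res_of_dvd h2 hPL
  have e0 := congrArg (Polynomial.eval 0) hL2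
  have e1 := congrArg (Polynomial.eval 1) hL2
  rw [eval_res] at e0 e1
  simp [L, pt] at e0 e1
  apply mul_ne_zero n1 n2
  linear_combination e1 - e0

theorem irr_case [Infinite F] {p : ℕ} [CharP F p] (h2 : (2:F) ≠ 0) (P : MvPolynomial (Fin 3) F)
    (hP : Irreducible P)
    (hDp : 4 * P.totalDegree < p) (R Bl : Finset (F × F × F))
    (hsk : ∀ r ∈ R, ∀ r' ∈ R, r ≠ r' → ¬ inc r r')
    (hinj : ∀ r ∈ R, ∀ r' ∈ R, r ≠ r' → r.1 ≠ r'.1)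
    (hZ : ∀ r ∈ R, res r P = 0) (hα : ∀ r ∈ R, ∀ b ∈ Bl, r.1 ≠ b.1) (k : ℕ)
    (hk : ∀ r ∈ R, ∀ r' ∈ R, r ≠ r' → (Bl.filter (fun b => inc r b ∧ inc r' b)).card ≤ k) :
    ∃ Bad ⊆ Bl, Bad.card ≤ 4 * P.totalDegree ^ 2 ∧
      ∑ b ∈ Bl \ Bad, nb R b ≤ 4 * P.totalDegree * Bl.card + k * R.card := by
  have hD0 := irr_deg_pos hP
  by_cases hD3 : 3 ≤ P.totalDegree
  · obtain ⟨Bad, h1, h3, h4⟩ := case_main (p := p) h2 P hP hDp R Bl hsk hZ hα hD3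
    refine ⟨Bad, h1, h3, ?_⟩
    have : ∑ b ∈ Bl \ Bad, nb R b ≤ ∑ b ∈ Bl \ Bad, 4 * P.totalDegree :=
      Finset.sum_le_sum fun b hb => h4 b (Finset.mem_sdiff.1 hb).1 (Finset.mem_sdiff.1 hb).2
    rw [Finset.sum_const, smul_eq_mul] at this
    have h5 := Finset.card_le_card (Finset.sdiff_subset (s := Bl) (t := Bad))
    nlinarith
  refine ⟨∅, Finset.empty_subset _, by simp, ?_⟩
  rw [Finset.sdiff_empty]
  have hnZ : ∀ b ∈ Bl, res b P ≠ 0 → nb R b ≤ P.totalDegree := by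
    intro b hb hbP
    refine (count_cross R _ b hsk (Finset.filter_subset _ _) (fun r hr => hα r hr b hb) P hbP ?_)
    intro r hr
    obtain ⟨hr, hi⟩ := Finset.mem_filter.1 hr
    refine ⟨hi, ?_⟩
    rw [← pt_cr hi (hα r hr b hb), ← eval_res, hZ r hr, Polynomial.eval_zero]
  have hnR : ∀ b, nb R b ≤ R.card := fun b => Finset.card_le_card (Finset.filter_subset _ _)
  by_cases hR : R.card ≤ 1
  · have : ∑ b ∈ Bl, nb R b ≤ ∑ b ∈ Bl, 1 := Finset.sum_le_sum fun b _ => (hnR b).trans hR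
    rw [Finset.sum_const, smul_eq_mul] at this
    nlinarith
  push Not at hR
  obtain ⟨r1, hr1, r2, hr2, hne⟩ := Finset.one_lt_card.1 hR
  set G := Bl.filter (fun b => inc r1 b ∧ inc r2 b) with hG
  have hGk : G.card ≤ k := hk r1 hr1 r2 hr2 hne
  have hb : ∀ b ∈ Bl, nb R b ≤ P.totalDegree + (if b ∈ G then R.card else 0) := by
    intro b hb
    by_cases hbG : b ∈ G
    · simp only [hbG, if_true]
      have := hnR b
      omega
    by_cases hbP : res b P = 0
    swap
    · have := hnZ b hb hbP
      omega
    have : nb R b = 0 := by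
      unfold nb
      rw [Finset.card_eq_zero, Finset.filter_eq_empty_iff]
      intro r hr hi
      apply hbG
      rw [hG, Finset.mem_filter]
      have key : ∀ r' ∈ R, inc r' b := by
        intro r' hr'
        by_cases hrr : r' = r
        · rw [hrr]; exact hi
        · exact small_deg P hP (by omega) r r' b (hsk r' hr' r hr hrr) (hinj r' hr' r hr hrr)
            (hα r hr b hb) (hα r' hr' b hb) (hZ r hr) (hZ r' hr') hbP hi
      exact ⟨hb, key r1 hr1, key r2 hr2⟩
    omega
  have hs := Finset.sum_le_sum hb
  rw [Finset.sum_add_distrib, Finset.sum_const, smul_eq_mul, ← Finset.sum_filter,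
    Finset.sum_const, smul_eq_mul] at hs
  have hGG : (Bl.filter (fun b => b ∈ G)).card ≤ k := by
    refine (Finset.card_le_card ?_).trans hGk
    intro b hb
    exact (Finset.mem_filter.1 hb).2
  have := Nat.mul_le_mul_right R.card hGG
  nlinarith

theorem propA [Infinite F] {p : ℕ} [CharP F p] (h2 : (2:F) ≠ 0) (P : MvPolynomial (Fin 3) F) :
    P ≠ 0 → 4 * P.totalDegree < p → ∀ (R Bl : Finset (F × F × F)),
    (∀ r ∈ R, ∀ r' ∈ R, r ≠ r' → ¬ inc r r') →
    (∀ r ∈ R, ∀ r' ∈ R, r ≠ r' → r.1 ≠ r'.1) →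
    (∀ r ∈ R, res r P = 0) → (∀ r ∈ R, ∀ b ∈ Bl, r.1 ≠ b.1) → ∀ (k : ℕ),
    (∀ r ∈ R, ∀ r' ∈ R, r ≠ r' → (Bl.filter (fun b => inc r b ∧ inc r' b)).card ≤ k) →
    ∃ Bad ⊆ Bl, Bad.card ≤ 4 * P.totalDegree ^ 2 ∧
      ∑ b ∈ Bl \ Bad, nb R b ≤ 4 * P.totalDegree * Bl.card + k * R.card := by
  induction P using WfDvdMonoid.induction_on_irreducible with
  | zero => intro h; exact absurd rfl h
  | unit u hu =>
    intro _ _ R Bl _ _ hZ _ k _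
    have hR : R = ∅ := by
      rw [Finset.eq_empty_iff_forall_notMem]
      intro r hr
      have h3 := hu.map (res r)
      rw [hZ r hr] at h3
      exact not_isUnit_zero h3
    refine ⟨∅, Finset.empty_subset _, by simp, ?_⟩
    subst hR
    simp [nb]
  | mul a i ha hi ih =>
    intro hne hDp R Bl hsk hinj hZ hα k hk
    have hi0 := hi.ne_zero
    rw [MvPolynomial.totalDegree_mul_of_isDomain hi0 ha] at hDp ⊢
    obtain ⟨B1, hB1, c1, s1⟩ := irr_case (p := p) h2 i hi (by omega) (R.filter (fun r => res r i = 0)) Bl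
      (fun r hr r' hr' => hsk r (Finset.mem_filter.1 hr).1 r' (Finset.mem_filter.1 hr').1)
      (fun r hr r' hr' => hinj r (Finset.mem_filter.1 hr).1 r' (Finset.mem_filter.1 hr').1)
      (fun r hr => (Finset.mem_filter.1 hr).2) (fun r hr => hα r (Finset.mem_filter.1 hr).1) k
      (fun r hr r' hr' => hk r (Finset.mem_filter.1 hr).1 r' (Finset.mem_filter.1 hr').1)
    obtain ⟨B2, hB2, c2, s2⟩ := ih ha (by omega) (R.filter (fun r => ¬ res r i = 0)) Bl
      (fun r hr r' hr' => hsk r (Finset.mem_filter.1 hr).1 r' (Finset.mem_filter.1 hr').1)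
      (fun r hr r' hr' => hinj r (Finset.mem_filter.1 hr).1 r' (Finset.mem_filter.1 hr').1)
      (fun r hr => by
        have h3 := hZ r (Finset.mem_filter.1 hr).1
        rw [map_mul] at h3
        exact (mul_eq_zero.1 h3).resolve_left (Finset.mem_filter.1 hr).2)
      (fun r hr => hα r (Finset.mem_filter.1 hr).1) k
      (fun r hr r' hr' => hk r (Finset.mem_filter.1 hr).1 r' (Finset.mem_filter.1 hr').1)
    refine ⟨B1 ∪ B2, Finset.union_subset hB1 hB2, ?_, ?_⟩
    · refine (Finset.card_union_le _ _).trans ?_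
      nlinarith [Nat.zero_le (i.totalDegree * a.totalDegree)]
    · have hsplit : ∀ b, nb R b = nb (R.filter (fun r => res r i = 0)) b +
          nb (R.filter (fun r => ¬ res r i = 0)) b := by
        intro b
        unfold nb
        rw [Finset.filter_filter, Finset.filter_filter]
        rw [← Finset.card_filter_add_card_filter_not (s := R.filter (fun r => inc r b)) (fun r => res r i = 0),
          Finset.filter_filter, Finset.filter_filter]
        congr 2 <;> (ext r; simp only [Finset.mem_filter]; tauto)
      have t1 : ∑ b ∈ Bl \ (B1 ∪ B2), nb (R.filter (fun r => res r i = 0)) b ≤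
          ∑ b ∈ Bl \ B1, nb (R.filter (fun r => res r i = 0)) b :=
        Finset.sum_le_sum_of_subset (Finset.sdiff_subset_sdiff le_rfl Finset.subset_union_left)
      have t2 : ∑ b ∈ Bl \ (B1 ∪ B2), nb (R.filter (fun r => ¬ res r i = 0)) b ≤
          ∑ b ∈ Bl \ B2, nb (R.filter (fun r => ¬ res r i = 0)) b :=
        Finset.sum_le_sum_of_subset (Finset.sdiff_subset_sdiff le_rfl Finset.subset_union_right)
      rw [Finset.sum_congr rfl (fun b _ => hsplit b), Finset.sum_add_distrib]
      have hc := Finset.card_filter_add_card_filter_not (s := R) (fun r => res r i = 0)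
      have hck : k * R.card = k * (R.filter (fun r => res r i = 0)).card +
        k * (R.filter (fun r => ¬ res r i = 0)).card := by rw [← mul_add, hc]
      rw [hck]
      nlinarith
end
end Rud

namespace Rud
section
variable {F : Type*} [Field F]
open Classical

theorem pieces (Bl : Finset (F × F × F)) (q : ℕ) (T : ℝ) (j : ℕ) : ∀ R : Finset (F × F × F),
    (∀ S ⊆ R, S.card ≤ q → ((∑ b ∈ Bl, nb S b : ℕ) : ℝ) ≤ T) → R.card ≤ j * q →
    ((∑ b ∈ Bl, nb R b : ℕ) : ℝ) ≤ j * T := by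
  induction j with
  | zero =>
    intro R _ hR
    have : R = ∅ := Finset.card_eq_zero.1 (by omega)
    subst this
    simp [nb]
  | succ j ih =>
    intro R hT hR
    obtain ⟨S, hSR, hS⟩ := Finset.exists_subset_card_eq (s := R) (n := min q R.card) (by omega)
    have h1 := hT S hSR (by omega)
    have h2 := ih (R \ S) (fun S' hS' => hT S' (hS'.trans Finset.sdiff_subset)) (by
      rw [Finset.card_sdiff_of_subset hSR]
      rw [add_mul] at hR
      omega)
    have hsplit : ∀ b, nb R b = nb S b + nb (R \ S) b := by
      intro b
      unfold nb
      rw [← Finset.card_union_of_disjoint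
        (Finset.disjoint_filter_filter Finset.disjoint_sdiff), ← Finset.filter_union,
        Finset.union_sdiff_of_subset hSR]
    rw [Finset.sum_congr rfl (fun b _ => hsplit b), Finset.sum_add_distrib]
    push_cast at *
    linarith

theorem thmN_aux [Infinite F] {p : ℕ} [CharP F p] (h2 : (2:F) ≠ 0) (k : ℕ) (t : ℝ)
    (ht : t = 192 * 768 ^ 8) (n : ℕ) : ∀ (u : ℝ), 0 ≤ u → u ^ 8 ≤ n → u ^ 8 ≤ (p:ℝ) ^ 2 →
    ∀ (R Bl : Finset (F × F × F)), (R.card : ℝ) ≤ u ^ 8 → (Bl.card : ℝ) ≤ u ^ 8 →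
    (∀ r ∈ R, ∀ r' ∈ R, r ≠ r' → ¬ inc r r') →
    (∀ r ∈ R, ∀ r' ∈ R, r ≠ r' → r.1 ≠ r'.1) →
    (∀ r ∈ R, ∀ b ∈ Bl, r.1 ≠ b.1) →
    (∀ r ∈ R, ∀ r' ∈ R, r ≠ r' → (Bl.filter (fun b => inc r b ∧ inc r' b)).card ≤ k) →
    ((∑ b ∈ Bl, nb R b : ℕ) : ℝ) ≤ 8 * t * (u ^ 12 + k * u ^ 9) := by
  have ht0 : 0 < t := by rw [ht]; norm_num
  induction n with
  | zero =>
    intro u hu hn _ R Bl hR hB _ _ _ _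
    have : R = ∅ := Finset.card_eq_zero.1 (by
      have : (R.card : ℝ) ≤ 0 := by push_cast at hn; linarith
      exact_mod_cast le_antisymm this (by positivity))
    subst this
    simp [nb]
    positivity
  | succ n ih =>
    intro u hu hn hp R Bl hR hB hsk hinj hα hk
    by_cases hR0 : R.card = 0
    · have : R = ∅ := Finset.card_eq_zero.1 hR0
      subst this
      simp [nb]
      positivity
    have hR1 : (1:ℝ) ≤ R.card := by exact_mod_cast Nat.pos_of_ne_zero hR0
    have hu1 : 1 ≤ u := by
      by_contra h
      push Not at h
      have := pow_lt_one₀ hu h (n := 8) (by norm_num)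
      linarith
    by_cases hsm : u ^ 8 < t
    · have h1 : ∑ b ∈ Bl, nb R b ≤ ∑ b ∈ Bl, R.card :=
        Finset.sum_le_sum fun b _ => Finset.card_le_card (Finset.filter_subset _ _)
      rw [Finset.sum_const, smul_eq_mul] at h1
      have h1' : ((∑ b ∈ Bl, nb R b : ℕ) : ℝ) ≤ Bl.card * R.card := by exact_mod_cast h1
      have h3 : (Bl.card : ℝ) * R.card ≤ u ^ 8 * t :=
        mul_le_mul hB (hR.trans hsm.le) (by positivity) (by positivity)
      have h4 : u ^ 8 ≤ u ^ 12 := pow_le_pow_right₀ hu1 (by norm_num)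
      have h5 : 0 ≤ (k:ℝ) * u ^ 9 := by positivity
      nlinarith [mul_le_mul_of_nonneg_right h4 ht0.le, mul_nonneg ht0.le h5, mul_nonneg ht0.le (pow_nonneg hu 12)]
    push Not at hsm
    obtain ⟨q, hq⟩ : ∃ q, q = ⌈u ^ 8 / t⌉₊ := ⟨_, rfl⟩
    have hq1 : u ^ 8 / t ≤ q := by rw [hq]; exact Nat.le_ceil _
    have hut : 1 ≤ u ^ 8 / t := by rw [le_div_iff₀ ht0]; linarith
    have hq2 : (q:ℝ) ≤ 2 * (u ^ 8 / t) := by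
      have := (Nat.ceil_lt_add_one (a := u ^ 8 / t) (by positivity)).le
      rw [← hq] at this
      linarith
    have hq0 : 1 ≤ q := by
      have : (1:ℝ) ≤ q := hut.trans hq1
      exact_mod_cast this
    obtain ⟨D, hD⟩ : ∃ D, D = Nat.sqrt (6 * q) + 1 := ⟨_, rfl⟩
    have hD1 : 6 * q ≤ D ^ 2 := by
      rw [hD, pow_two]; exact (Nat.lt_succ_sqrt (6 * q)).le
    have hD2 : D ^ 2 ≤ 24 * q := by
      have h1 := Nat.sqrt_le (6 * q)
      have h3 : 1 ≤ Nat.sqrt (6 * q) := Nat.sqrt_pos.2 (by omega)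
      rw [hD]
      nlinarith
    have hD2r : (D:ℝ) ^ 2 ≤ 24 * q := by exact_mod_cast hD2
    have hdiv : u ^ 8 / t = u ^ 8 * (1 / t) := by ring
    have ht1 : 1 / t ≤ 1 / 10000 := by
      apply one_div_le_one_div_of_le (by norm_num)
      rw [ht]; norm_num
    have hu8 : 0 < u ^ 8 := by positivity
    have hsmall : u ^ 8 / t ≤ u ^ 8 / 10000 := by
      rw [hdiv]; nlinarith
    have hDu : (D:ℝ) ≤ u ^ 4 := by
      refine le_of_pow_le_pow_left₀ (n := 2) (by norm_num) (by positivity) ?_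
      nlinarith
    have hDp : 4 * D < p := by
      have : ((4 * D : ℕ):ℝ) < p := by
        apply lt_of_pow_lt_pow_left₀ 2 (by positivity)
        push_cast
        nlinarith
      exact_mod_cast this
    have hρ : (u / 768) ^ 8 = 192 * (u ^ 8 / t) := by
      rw [ht, div_pow]; field_simp
    have hpiece : ∀ S ⊆ R, S.card ≤ q → ((∑ b ∈ Bl, nb S b : ℕ) : ℝ) ≤
        4 * u ^ 4 * u ^ 8 + k * (2 * (u ^ 8 / t)) +
          8 * t * ((u / 768) ^ 12 + k * (u / 768) ^ 9) := by
      intro S hSR hSq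
      obtain ⟨P, hP0, hPD, hPS⟩ := exists_interp S D (by omega)
      obtain ⟨Bad, hBB, hBc, hBs⟩ := propA (p := p) h2 P hP0 (by omega) S Bl
        (fun r hr r' hr' => hsk r (hSR hr) r' (hSR hr'))
        (fun r hr r' hr' => hinj r (hSR hr) r' (hSR hr')) hPS
        (fun r hr => hα r (hSR hr)) k
        (fun r hr r' hr' => hk r (hSR hr) r' (hSR hr'))
      have hBad : (Bad.card : ℝ) ≤ 96 * q := by
        have : Bad.card ≤ 96 * q := by
          have := Nat.pow_le_pow_left hPD 2
          omega
        exact_mod_cast this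
      have hSr : (S.card : ℝ) ≤ q := by exact_mod_cast hSq
      have h3 := ih (u / 768) (by positivity) (by
          rw [hρ]; push_cast at hn
          have : 10000 ≤ u ^ 8 := by
            rw [ht] at hsm
            refine le_trans ?_ hsm
            norm_num
          nlinarith) (by rw [hρ]; linarith) S Bad (by rw [hρ]; linarith) (by rw [hρ]; linarith)
        (fun r hr r' hr' => hsk r (hSR hr) r' (hSR hr'))
        (fun r hr r' hr' => hinj r (hSR hr) r' (hSR hr'))
        (fun r hr b hb => hα r (hSR hr) b (hBB hb))
        (fun r hr r' hr' hne => (Finset.card_le_card (Finset.filter_subset_filter _ hBB)).trans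
          (hk r (hSR hr) r' (hSR hr') hne))
      have h4 := Finset.sum_sdiff (f := nb S) hBB
      have h5 : ((∑ b ∈ Bl \ Bad, nb S b : ℕ) : ℝ) ≤ 4 * P.totalDegree * Bl.card + k * S.card := by
        exact_mod_cast hBs
      have h6 : (P.totalDegree : ℝ) ≤ D := by exact_mod_cast hPD
      have h7 : (P.totalDegree : ℝ) * Bl.card ≤ u ^ 4 * u ^ 8 :=
        mul_le_mul (h6.trans hDu) hB (by positivity) (by positivity)
      have h8 : (k:ℝ) * S.card ≤ k * (2 * (u ^ 8 / t)) :=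
        mul_le_mul_of_nonneg_left (hSr.trans hq2) (by positivity)
      rw [← h4, Nat.cast_add]
      linarith
    have htq : R.card ≤ (192 * 768 ^ 8) * q := by
      have h1 : u ^ 8 ≤ t * q := by
        rw [div_le_iff₀ ht0] at hq1; linarith
      have : (R.card : ℝ) ≤ ((192 * 768 ^ 8 * q : ℕ) : ℝ) := by
        rw [Nat.cast_mul]; push_cast
        rw [ht] at h1; linarith
      exact_mod_cast this
    have hfin := pieces Bl q _ _ R hpiece htq
    refine hfin.trans ?_
    have hcast : ((192 * 768 ^ 8 : ℕ) : ℝ) = t := by rw [ht]; push_cast; ring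
    rw [hcast]
    have e1 : t * (u / 768) ^ 9 = u ^ 9 / 4 := by rw [ht]; ring
    have e2 : t * (u / 768) ^ 12 ≤ u ^ 12 / 4 := by
      have : t * (u / 768) ^ 12 = u ^ 12 / 4 / 768 ^ 3 := by rw [ht]; ring
      rw [this]
      exact div_le_self (by positivity) (by norm_num)
    have e3 : t * (u ^ 8 / t) = u ^ 8 := by field_simp
    have e4 : u ^ 8 ≤ u ^ 9 := pow_le_pow_right₀ hu1 (by norm_num)
    have ht2 : 1 ≤ t := by rw [ht]; norm_num
    have e5 : (k:ℝ) * u ^ 8 ≤ k * u ^ 9 := mul_le_mul_of_nonneg_left e4 (by positivity)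
    have e6 : 0 ≤ (k:ℝ) * u ^ 9 := by positivity
    calc t * (4 * u ^ 4 * u ^ 8 + k * (2 * (u ^ 8 / t)) +
          8 * t * ((u / 768) ^ 12 + k * (u / 768) ^ 9))
        = 4 * t * u ^ 12 + 2 * k * (t * (u ^ 8 / t)) + 8 * t * (t * (u / 768) ^ 12 + k * (t * (u / 768) ^ 9)) := by ring
      _ ≤ 4 * t * u ^ 12 + 2 * (k * u ^ 9) + 8 * t * (u ^ 12 / 4 + k * (u ^ 9 / 4)) := by
        rw [e1, e3]
        have := mul_le_mul_of_nonneg_left e2 (by positivity : 0 ≤ 8 * t)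
        nlinarith
      _ ≤ _ := by
        nlinarith [mul_le_mul_of_nonneg_right ht2 e6, mul_nonneg ht0.le (pow_nonneg hu 12)]

/-- The constant. -/
noncomputable def CN : ℝ := 8 * (192 * 768 ^ 8)

theorem thmN [Infinite F] {p : ℕ} [CharP F p] (h2 : (2:F) ≠ 0) (k : ℕ)
    (u : ℝ) (hu : 0 ≤ u) (hp : u ^ 8 ≤ (p:ℝ) ^ 2)
    (R Bl : Finset (F × F × F)) (hR : (R.card : ℝ) ≤ u ^ 8) (hB : (Bl.card : ℝ) ≤ u ^ 8)
    (hsk : ∀ r ∈ R, ∀ r' ∈ R, r ≠ r' → ¬ inc r r')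
    (hinj : ∀ r ∈ R, ∀ r' ∈ R, r ≠ r' → r.1 ≠ r'.1)
    (hα : ∀ r ∈ R, ∀ b ∈ Bl, r.1 ≠ b.1)
    (hk : ∀ r ∈ R, ∀ r' ∈ R, r ≠ r' → (Bl.filter (fun b => inc r b ∧ inc r' b)).card ≤ k) :
    ((∑ b ∈ Bl, nb R b : ℕ) : ℝ) ≤ CN * (u ^ 12 + k * u ^ 9) :=
  thmN_aux (p := p) h2 k _ rfl ⌈u ^ 8⌉₊ u hu (Nat.le_ceil _) hp R Bl hR hB hsk hinj hα hk
end
end Rud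

namespace Rud
section
variable {F : Type*} [Field F]
open Classical

/-- Incidence between red and blue triples. -/
def II {K : Type*} [Field K] (r b : K × K × K) : Prop :=
  r.1 * b.1 - b.2.1 * r.2.1 + r.2.2 - b.2.2 = 0

theorem avoid [Infinite F] {ι : Type*} (s : Finset ι) (a b : ι → F)
    (h : ∀ i ∈ s, a i ≠ 0 ∨ b i ≠ 0) {κ : Type*} (t : Finset κ) (c d : κ → F)
    (h' : ∀ i ∈ t, c i ≠ 0 ∨ d i ≠ 0) :
    ∃ x, (∀ i ∈ s, a i * x + b i ≠ 0) ∧ (∀ i ∈ t, c i * x + d i ≠ 0) := by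
  obtain ⟨x, hx⟩ := Infinite.exists_notMem_finset
    (s.image (fun i => - b i / a i) ∪ t.image (fun i => - d i / c i))
  have aux : ∀ u v : F, (u ≠ 0 ∨ v ≠ 0) → x ≠ - v / u → u * x + v ≠ 0 := by
    intro u v h1 h2 h3
    by_cases hu : u = 0
    · rw [hu] at h3 h1
      simp at h3 h1
      exact h1 h3
    · apply h2
      rw [eq_div_iff hu]
      linear_combination h3
  refine ⟨x, fun i hi => aux _ _ (h i hi) ?_, fun i hi => aux _ _ (h' i hi) ?_⟩
  · rintro rfl
    exact hx (Finset.mem_union_left _ (Finset.mem_image.2 ⟨i, hi, rfl⟩))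
  · rintro rfl
    exact hx (Finset.mem_union_right _ (Finset.mem_image.2 ⟨i, hi, rfl⟩))

theorem thmR_aux [Infinite F] {p : ℕ} [CharP F p] (h2 : (2:F) ≠ 0) (k : ℕ)
    (u : ℝ) (hu : 0 ≤ u) (hp : u ^ 8 ≤ (p:ℝ) ^ 2)
    (R Bl : Finset (F × F × F)) (hR : (R.card : ℝ) ≤ u ^ 8) (hB : (Bl.card : ℝ) ≤ u ^ 8)
    (hk : ∀ r ∈ R, ∀ r' ∈ R, r ≠ r' → (Bl.filter (fun b => II r b ∧ II r' b)).card ≤ k) :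
    ((∑ b ∈ Bl, (R.filter (fun r => II r b)).card : ℕ) : ℝ) ≤ CN * (u ^ 12 + k * u ^ 9) := by
  obtain ⟨κ, hκ1, hκ2⟩ := avoid ((R ×ˢ R).filter (fun q => q.1.2.1 ≠ q.2.2.1 ∨ q.1.2.2 ≠ q.2.2.2))
    (fun q => q.1.2.2 - q.2.2.2) (fun q => q.1.2.1 - q.2.2.1) (by
      intro q hq
      rcases (Finset.mem_filter.1 hq).2 with h | h
      · right; exact sub_ne_zero.2 h
      · left; exact sub_ne_zero.2 h) Bl (fun b => b.2.1) (fun _ => 1) (by simp)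
  obtain ⟨θ, hθ, -⟩ := avoid ((R ×ˢ R).filter (fun q => q.1 ≠ q.2))
    (fun q => q.1.1 - q.2.1) (fun q => q.1.2.1 - q.2.2.1 + κ * (q.1.2.2 - q.2.2.2)) (by
      intro q hq
      obtain ⟨hq1, hq2⟩ := Finset.mem_filter.1 hq
      by_cases hx : q.1.1 = q.2.1
      · right
        have := hκ1 q (Finset.mem_filter.2 ⟨hq1, by
          by_contra hcon
          push Not at hcon
          exact hq2 (Prod.ext hx (Prod.ext hcon.1 hcon.2))⟩)
        intro h
        apply this
        linear_combination h
      · left; exact sub_ne_zero.2 hx) (∅ : Finset ℕ) (fun _ => 0) (fun _ => 0) (by simp)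
  obtain ⟨ν, hν, -⟩ := avoid R (fun _ => 1) (fun r => r.2.1 + κ * r.2.2 + θ * r.1) (by simp)
    (∅ : Finset ℕ) (fun _ => 0) (fun _ => 0) (by simp)
  obtain ⟨α, hα⟩ : ∃ α : F × F × F → F, α = fun r => r.2.1 + κ * r.2.2 + θ * r.1 + ν := ⟨_, rfl⟩
  have hα0 : ∀ r ∈ R, α r ≠ 0 := by
    intro r hr h
    apply hν r hr
    rw [hα] at h
    linear_combination h
  have hαi : ∀ r ∈ R, ∀ r' ∈ R, r ≠ r' → α r ≠ α r' := by
    intro r hr r' hr' hne h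
    apply hθ (r, r') (Finset.mem_filter.2 ⟨Finset.mem_product.2 ⟨hr, hr'⟩, hne⟩)
    rw [hα] at h
    linear_combination h
  obtain ⟨μ, hμ, -⟩ := avoid ((R ×ˢ R).filter (fun q => q.1 ≠ q.2))
    (fun q => α q.2 - α q.1) (fun q => q.1.1 * α q.2 - q.2.1 * α q.1) (by
      intro q hq
      obtain ⟨hq1, hq2⟩ := Finset.mem_filter.1 hq
      obtain ⟨hq3, hq4⟩ := Finset.mem_product.1 hq1
      left
      exact sub_ne_zero.2 (hαi _ hq4 _ hq3 (Ne.symm hq2))) (∅ : Finset ℕ) (fun _ => 0) (fun _ => 0) (by simp)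
  obtain ⟨Y, hY⟩ : ∃ Y : F × F × F → F, Y = fun b => (b.1 + θ * b.2.1) / (1 + κ * b.2.1) := ⟨_, rfl⟩
  have hw : ∀ b ∈ Bl, 1 + κ * b.2.1 ≠ 0 := by
    intro b hb h
    apply hκ2 b hb
    linear_combination h
  obtain ⟨lam, hl1, hl2⟩ := avoid ((R ×ˢ R).filter (fun q => q.1 ≠ q.2))
    (fun q => (q.1.1 + μ) * α q.2 - (q.2.1 + μ) * α q.1) (fun q => q.1.2.2 - q.2.2.2) (by
      intro q hq
      left
      intro h
      apply hμ q hq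
      linear_combination h) (insert none ((R ×ˢ Bl).image some))
    (fun q => match q with | none => 1 | some q => α q.1)
    (fun q => match q with | none => 0 | some q => - Y q.2) (by
      intro q hq
      left
      rcases q with _ | q
      · simp
      · simp only [Finset.mem_insert, Finset.mem_image, Finset.mem_product] at hq
        rcases hq with hq | ⟨q', hq', h⟩
        · cases hq
        · cases h
          exact hα0 _ hq'.1)
  have hlam : lam ≠ 0 := by
    have := hl2 none (by simp)
    simpa using this
  have hlY : ∀ r ∈ R, ∀ b ∈ Bl, α r ≠ Y b / lam := by
    intro r hr b hb h
    have := hl2 (some (r, b)) (by simp [hr, hb])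
    apply this
    rw [eq_div_iff hlam] at h
    simp only
    linear_combination h
  let φ : F × F × F → F × F × F := fun r => (α r, lam * (r.1 + μ), - r.2.2)
  let ψ : F × F × F → F × F × F := fun b => (Y b / lam, b.2.1 / (1 + κ * b.2.1),
    (ν * b.2.1 - b.2.2) / (1 + κ * b.2.1) - μ * Y b)
  have hinc : ∀ r, ∀ b ∈ Bl, inc (φ r) (ψ b) ↔ II r b := by
    intro r b hb
    have h := hw b hb
    have hYw : Y b * (1 + κ * b.2.1) = b.1 + θ * b.2.1 := by
      rw [hY]; exact div_mul_cancel₀ _ h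
    obtain ⟨c, hc⟩ : ∃ c, c = b.2.1 / (1 + κ * b.2.1) := ⟨_, rfl⟩
    obtain ⟨d, hd⟩ : ∃ d, d = (ν * b.2.1 - b.2.2) / (1 + κ * b.2.1) := ⟨_, rfl⟩
    obtain ⟨e, he⟩ : ∃ e, e = Y b / lam := ⟨_, rfl⟩
    have hc' : c * (1 + κ * b.2.1) = b.2.1 := by rw [hc]; exact div_mul_cancel₀ _ h
    have hd' : d * (1 + κ * b.2.1) = ν * b.2.1 - b.2.2 := by rw [hd]; exact div_mul_cancel₀ _ h
    have he' : e * lam = Y b := by rw [he]; exact div_mul_cancel₀ _ hlam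
    have hα' : α r = r.2.1 + κ * r.2.2 + θ * r.1 + ν := by rw [hα]
    simp only [inc, φ, ψ, II]
    rw [← hc, ← hd, ← he]
    constructor
    · intro hh
      linear_combination -(1 + κ * b.2.1) * hh - hd' + (α r) * hc' - r.1 * hYw
        - (r.1 + μ) * (1 + κ * b.2.1) * he' + b.2.1 * hα'
    · intro hh
      apply mul_left_cancel₀ h
      linear_combination - hh - hd' + (α r) * hc' - r.1 * hYw
        - (r.1 + μ) * (1 + κ * b.2.1) * he' + b.2.1 * hα'
  have hφ : ∀ r ∈ R, ∀ r' ∈ R, φ r = φ r' → r = r' := by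
    intro r hr r' hr' h
    by_contra hne
    exact hαi r hr r' hr' hne (congrArg Prod.fst h)
  have hψ : ∀ b ∈ Bl, ∀ b' ∈ Bl, ψ b = ψ b' → b = b' := by
    intro b hb b' hb' h
    have w1 := hw b hb
    have w2 := hw b' hb'
    have e1 : Y b / lam = Y b' / lam := congrArg Prod.fst h
    have e2 : b.2.1 / (1 + κ * b.2.1) = b'.2.1 / (1 + κ * b'.2.1) := congrArg (fun q => q.2.1) h
    have e3 : (ν * b.2.1 - b.2.2) / (1 + κ * b.2.1) - μ * Y b =
      (ν * b'.2.1 - b'.2.2) / (1 + κ * b'.2.1) - μ * Y b' := congrArg (fun q => q.2.2) h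
    have f1 : Y b = Y b' := by
      rwa [div_left_inj' hlam] at e1
    rw [div_eq_div_iff w1 w2] at e2
    have f2 : b.2.1 = b'.2.1 := by linear_combination e2
    rw [f1, f2] at e3
    rw [f2] at w1
    have f3 : b.2.2 = b'.2.2 := by
      have := (div_left_inj' w1).1 (sub_left_inj.1 e3)
      linear_combination -this
    have f4 : b.1 = b'.1 := by
      rw [hY] at f1
      simp only at f1
      rw [f2] at f1
      have := (div_left_inj' w1).1 f1
      linear_combination this
    exact Prod.ext f4 (Prod.ext f2 f3)
  have main := thmN (p := p) h2 k u hu hp (R.image φ) (Bl.image ψ)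
    (le_trans (by exact_mod_cast Finset.card_image_le) hR)
    (le_trans (by exact_mod_cast Finset.card_image_le) hB)
    (by
      intro r hr0 r' hr0' hne hi
      obtain ⟨r, hr, rfl⟩ := Finset.mem_image.1 hr0
      obtain ⟨r', hr', rfl⟩ := Finset.mem_image.1 hr0'
      have hne' : r ≠ r' := fun h => hne (by rw [h])
      apply hl1 (r, r') (Finset.mem_filter.2 ⟨Finset.mem_product.2 ⟨hr, hr'⟩, hne'⟩)
      simp only [inc, φ] at hi
      simp only
      linear_combination -hi)
    (by
      intro r hr0 r' hr0' hne hi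
      obtain ⟨r, hr, rfl⟩ := Finset.mem_image.1 hr0
      obtain ⟨r', hr', rfl⟩ := Finset.mem_image.1 hr0'
      have hne' : r ≠ r' := fun h => hne (by rw [h])
      exact hαi r hr r' hr' hne' hi)
    (by
      intro r hr0 b hb0 hi
      obtain ⟨r, hr, rfl⟩ := Finset.mem_image.1 hr0
      obtain ⟨b, hb, rfl⟩ := Finset.mem_image.1 hb0
      exact hlY r hr b hb hi)
    (by
      intro r hr0 r' hr0' hne
      obtain ⟨r, hr, rfl⟩ := Finset.mem_image.1 hr0
      obtain ⟨r', hr', rfl⟩ := Finset.mem_image.1 hr0'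
      have hne' : r ≠ r' := fun h => hne (by rw [h])
      refine le_trans ?_ (hk r hr r' hr' hne')
      rw [Finset.filter_image]
      refine Finset.card_image_le.trans (Finset.card_le_card ?_)
      intro b hb
      obtain ⟨hb, h1, h2⟩ := Finset.mem_filter.1 hb
      exact Finset.mem_filter.2 ⟨hb, (hinc r b hb).1 h1, (hinc r' b hb).1 h2⟩)
  rw [Finset.sum_image hψ] at main
  refine le_trans (le_of_eq ?_) main
  congr 1
  apply Finset.sum_congr rfl
  intro b hb
  unfold nb
  rw [Finset.filter_image, Finset.card_image_of_injOn]
  · congr 1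
    apply Finset.filter_congr
    intro r hr
    exact (hinc r b hb).symm
  · intro r hr r' hr' h
    exact hφ r (Finset.mem_filter.1 hr).1 r' (Finset.mem_filter.1 hr').1 h

theorem thmR {p : ℕ} [Fact p.Prime] (hp2 : 2 < p) (k : ℕ)
    (u : ℝ) (hu : 0 ≤ u) (hp : u ^ 8 ≤ (p:ℝ) ^ 2)
    (R Bl : Finset (ZMod p × ZMod p × ZMod p)) (hR : (R.card : ℝ) ≤ u ^ 8) (hB : (Bl.card : ℝ) ≤ u ^ 8)
    (hk : ∀ r ∈ R, ∀ r' ∈ R, r ≠ r' → (Bl.filter (fun b => II r b ∧ II r' b)).card ≤ k) :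
    ((∑ b ∈ Bl, (R.filter (fun r => II r b)).card : ℕ) : ℝ) ≤ CN * (u ^ 12 + k * u ^ 9) := by
  let F := AlgebraicClosure (ZMod p)
  have : CharP F p := charP_of_injective_algebraMap (algebraMap (ZMod p) F).injective p
  have h2 : (2:F) ≠ 0 := by
    intro h
    have : ((2:ℕ):F) = 0 := by exact_mod_cast h
    rw [CharP.cast_eq_zero_iff F p] at this
    have := Nat.le_of_dvd (by norm_num) this
    omega
  let ι : ZMod p →+* F := algebraMap (ZMod p) F
  have hι : Function.Injective ι := ι.injective
  let J : ZMod p × ZMod p × ZMod p → F × F × F := fun r => (ι r.1, ι r.2.1, ι r.2.2)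
  have hJ : Function.Injective J := by
    intro r r' h
    exact Prod.ext (hι (congrArg Prod.fst h)) (Prod.ext (hι (congrArg (fun q => q.2.1) h))
      (hι (congrArg (fun q => q.2.2) h)))
  have hII : ∀ r b, II (J r) (J b) ↔ II r b := by
    intro r b
    simp only [II, J]
    rw [← map_mul, ← map_mul, ← map_sub, ← map_add, ← map_sub, map_eq_zero_iff ι hι]
  have main := thmR_aux (p := p) h2 k u hu hp (R.image J) (Bl.image J)
    (by rwa [Finset.card_image_of_injective _ hJ]) (by rwa [Finset.card_image_of_injective _ hJ])
    (by
      intro r hr0 r' hr0' hne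
      obtain ⟨r, hr, rfl⟩ := Finset.mem_image.1 hr0
      obtain ⟨r', hr', rfl⟩ := Finset.mem_image.1 hr0'
      have hne' : r ≠ r' := fun h => hne (by rw [h])
      refine le_trans ?_ (hk r hr r' hr' hne')
      rw [Finset.filter_image]
      refine Finset.card_image_le.trans (le_of_eq ?_)
      simp only [hII])
  rw [Finset.sum_image hJ.injOn] at main
  refine le_trans (le_of_eq ?_) main
  congr 1
  apply Finset.sum_congr rfl
  intro b hb
  rw [Finset.filter_image, Finset.card_image_of_injective _ hJ]
  simp only [hII]
end
end Rud

namespace Rud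
section
open Classical

theorem common {K : Type*} [Field K] (Bl : Finset (K × K × K)) (X Y : Finset K) (k : ℕ)
    (hX : X.card ≤ k) (hY : Y.card ≤ k) (hBX : ∀ b ∈ Bl, b.2.1 ∈ X) (hBY : ∀ b ∈ Bl, b.1 ∈ Y)
    (r r' : K × K × K) (hne : r ≠ r') :
    (Bl.filter (fun b => II r b ∧ II r' b)).card ≤ k := by
  by_cases h1 : r.1 = r'.1
  · by_cases h2 : r.2.1 = r'.2.1
    · have : Bl.filter (fun b => II r b ∧ II r' b) = ∅ := by
        rw [Finset.filter_eq_empty_iff]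
        rintro b - ⟨e1, e2⟩
        unfold II at e1 e2
        apply hne
        refine Prod.ext h1 (Prod.ext h2 ?_)
        rw [h1, h2] at e1
        linear_combination e1 - e2
      rw [this]
      simp
    · refine le_trans (Finset.card_le_card_of_injOn (fun b => b.1) ?_ ?_) hY
      · intro b hb
        exact hBY b (Finset.mem_filter.1 hb).1
      · intro b hb b' hb' hbb
        obtain ⟨-, e1, e2⟩ := Finset.mem_filter.1 hb
        obtain ⟨-, e3, e4⟩ := Finset.mem_filter.1 hb'
        simp only at hbb
        unfold II at e1 e2 e3 e4
        have h3 : b.2.1 = b'.2.1 := by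
          apply mul_left_cancel₀ (sub_ne_zero.2 h2)
          rw [hbb, h1] at e1
          rw [hbb] at e2
          rw [h1] at e3
          linear_combination e3 - e4 - e1 + e2
        refine Prod.ext hbb (Prod.ext h3 ?_)
        rw [hbb, h3] at e1
        linear_combination e3 - e1
  · refine le_trans (Finset.card_le_card_of_injOn (fun b => b.2.1) ?_ ?_) hX
    · intro b hb
      exact hBX b (Finset.mem_filter.1 hb).1
    · intro b hb b' hb' hbb
      obtain ⟨-, e1, e2⟩ := Finset.mem_filter.1 hb
      obtain ⟨-, e3, e4⟩ := Finset.mem_filter.1 hb'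
      simp only at hbb
      unfold II at e1 e2 e3 e4
      have h3 : b.1 = b'.1 := by
        apply mul_left_cancel₀ (sub_ne_zero.2 h1)
        rw [hbb] at e1 e2
        linear_combination e1 - e2 - e3 + e4
      refine Prod.ext h3 (Prod.ext hbb ?_)
      rw [hbb, h3] at e1
      linear_combination e3 - e1

theorem cs {α β : Type*} (T : Finset α) (W : Finset β) (h : α → β) (hW : ∀ t ∈ T, h t ∈ W) :
    T.card ^ 2 ≤ W.card * ((T ×ˢ T).filter (fun q => h q.1 = h q.2)).card := by
  have h1 := Finset.card_eq_sum_card_fiberwise (f := h) (s := T) (t := W) hW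
  have h2 : ((T ×ˢ T).filter (fun q => h q.1 = h q.2)).card =
      ∑ w ∈ W, (T.filter (fun t => h t = w)).card ^ 2 := by
    rw [Finset.card_eq_sum_card_fiberwise (f := fun q => h q.1)
      (s := (T ×ˢ T).filter (fun q => h q.1 = h q.2)) (t := W)]
    · apply Finset.sum_congr rfl
      intro w _
      rw [pow_two, ← Finset.card_product]
      congr 1
      ext q
      simp only [Finset.mem_filter, Finset.mem_product]
      constructor
      · rintro ⟨⟨⟨a, b⟩, c⟩, d⟩
        exact ⟨⟨a, d⟩, b, c ▸ d⟩
      · rintro ⟨⟨a, d⟩, b, c⟩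
        exact ⟨⟨⟨a, b⟩, d.trans c.symm⟩, d⟩
    · intro q hq
      exact hW _ (Finset.mem_product.1 (Finset.mem_filter.1 hq).1).1
  rw [h2, h1]
  exact sq_sum_le_card_mul_sum_sq

theorem energy {p : ℕ} [Fact p.Prime] (hp2 : 2 < p) (γ α β lam μ δ : ZMod p) (hγ : γ ≠ 0)
    (G : ZMod p → ZMod p → ZMod p)
    (hG : ∀ x y, G x y = γ * x * y + α * x ^ 2 + β * y ^ 2 + lam * x + μ * y + δ)
    (X Y Z : Finset (ZMod p)) (v : ℝ) (hv : 0 ≤ v) (hvp : v ^ 16 ≤ (p:ℝ) ^ 2)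
    (hm : (X.card : ℝ) * Y.card * Z.card ≤ v ^ 16) (hX : (X.card : ℝ) ≤ v ^ 6)
    (hY : (Y.card : ℝ) ≤ v ^ 6)
    (T : Finset (ZMod p × ZMod p × ZMod p)) (hT : T ⊆ X ×ˢ Y ×ˢ Z) (W : Finset (ZMod p))
    (hW : ∀ t ∈ T, t.2.2 + G t.1 t.2.1 ∈ W) :
    (T.card : ℝ) ^ 2 ≤ W.card * (2 * CN * v ^ 24) := by
  have hcs := cs T W (fun t => t.2.2 + G t.1 t.2.1) hW
  let ρ : ZMod p × ZMod p × ZMod p → ZMod p × ZMod p × ZMod p := fun t =>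
    (γ * t.1, t.2.1, t.2.2 + α * t.1 ^ 2 + lam * t.1 - β * t.2.1 ^ 2 - μ * t.2.1)
  let σ : ZMod p × ZMod p × ZMod p → ZMod p × ZMod p × ZMod p := fun t =>
    (t.2.1, γ * t.1, t.2.2 + α * t.1 ^ 2 + lam * t.1 - β * t.2.1 ^ 2 - μ * t.2.1)
  let R := (X ×ˢ Y ×ˢ Z).image ρ
  let Bl := (X ×ˢ Y ×ˢ Z).image σ
  have hc : (X ×ˢ Y ×ˢ Z).card = X.card * Y.card * Z.card := by
    rw [Finset.card_product, Finset.card_product, mul_assoc]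
  have hcr : (((X ×ˢ Y ×ˢ Z).card : ℕ) : ℝ) ≤ (v ^ 2) ^ 8 := by
    rw [hc]; push_cast
    calc _ ≤ v ^ 16 := hm
      _ = _ := by ring
  have hmain := thmR hp2 (max X.card Y.card) (v ^ 2) (by positivity)
    (by calc _ = v ^ 16 := by ring
          _ ≤ _ := hvp) R Bl
    (le_trans (by exact_mod_cast Finset.card_image_le) hcr)
    (le_trans (by exact_mod_cast Finset.card_image_le) hcr)
    (by
      intro r _ r' _ hne
      refine common Bl (X.image (fun x => γ * x)) Y _
        (Finset.card_image_le.trans (le_max_left _ _)) (le_max_right _ _) ?_ ?_ r r' hne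
      · intro b hb
        obtain ⟨t, ht, rfl⟩ := Finset.mem_image.1 hb
        exact Finset.mem_image_of_mem _ (Finset.mem_product.1 ht).1
      · intro b hb
        obtain ⟨t, ht, rfl⟩ := Finset.mem_image.1 hb
        exact (Finset.mem_product.1 (Finset.mem_product.1 ht).2).1)
  have hE : ((T ×ˢ T).filter (fun q => q.1.2.2 + G q.1.1 q.1.2.1 = q.2.2.2 + G q.2.1 q.2.2.1)).card
      ≤ ∑ b ∈ Bl, (R.filter (fun r => II r b)).card := by
    have e : ∑ b ∈ Bl, (R.filter (fun r => II r b)).card =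
        ((R ×ˢ Bl).filter (fun q => II q.1 q.2)).card := by
      rw [Finset.card_filter, Finset.sum_product_right]
      apply Finset.sum_congr rfl
      intro b _
      rw [Finset.card_filter]
    rw [e]
    refine Finset.card_le_card_of_injOn
      (fun q => (ρ (q.1.1, q.2.2.1, q.1.2.2), σ (q.2.1, q.1.2.1, q.2.2.2))) ?_ ?_
    · intro q hq
      obtain ⟨h1, h2⟩ := Finset.mem_filter.1 hq
      obtain ⟨h3, h4⟩ := Finset.mem_product.1 h1
      have h5 := hT h3
      have h6 := hT h4
      simp only [Finset.mem_product] at h5 h6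
      refine Finset.mem_filter.2 ⟨Finset.mem_product.2 ⟨Finset.mem_image_of_mem _ ?_,
        Finset.mem_image_of_mem _ ?_⟩, ?_⟩
      · simp only [Finset.mem_product]
        exact ⟨h5.1, h6.2.1, h5.2.2⟩
      · simp only [Finset.mem_product]
        exact ⟨h6.1, h5.2.1, h6.2.2⟩
      · rw [hG, hG] at h2
        simp only [II, ρ, σ]
        linear_combination h2
    · intro q _ q' _ h
      have a1 := congrArg (fun q => q.1.1) h
      have a2 := congrArg (fun q => q.1.2.1) h
      have a3 := congrArg (fun q => q.1.2.2) h
      have a4 := congrArg (fun q => q.2.1) h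
      have a5 := congrArg (fun q => q.2.2.1) h
      have a6 := congrArg (fun q => q.2.2.2) h
      simp only [ρ, σ] at a1 a2 a3 a4 a5 a6
      have b1 := mul_left_cancel₀ hγ a1
      have b5 := mul_left_cancel₀ hγ a5
      rw [b1, a2] at a3
      rw [b5, a4] at a6
      have b3 : q.1.2.2 = q'.1.2.2 := by linear_combination a3
      have b6 : q.2.2.2 = q'.2.2.2 := by linear_combination a6
      exact Prod.ext (Prod.ext b1 (Prod.ext a4 b3)) (Prod.ext b5 (Prod.ext a2 b6))
  have hcs' : (T.card : ℝ) ^ 2 ≤ W.card *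
      ((T ×ˢ T).filter (fun q => q.1.2.2 + G q.1.1 q.1.2.1 = q.2.2.2 + G q.2.1 q.2.2.1)).card := by
    have hcs2 : T.card ^ 2 ≤ W.card *
        ((T ×ˢ T).filter (fun q => q.1.2.2 + G q.1.1 q.1.2.1 = q.2.2.2 + G q.2.1 q.2.2.1)).card := by
      convert hcs
    exact_mod_cast hcs2
  refine hcs'.trans (mul_le_mul_of_nonneg_left ?_ (by positivity))
  have hE' : (((T ×ˢ T).filter (fun q => q.1.2.2 + G q.1.1 q.1.2.1 = q.2.2.2 + G q.2.1 q.2.2.1)).card : ℝ)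
      ≤ ((∑ b ∈ Bl, (R.filter (fun r => II r b)).card : ℕ) : ℝ) := by exact_mod_cast hE
  refine hE'.trans (hmain.trans ?_)
  have hk : ((max X.card Y.card : ℕ) : ℝ) ≤ v ^ 6 := by
    rw [Nat.cast_max]; exact max_le hX hY
  have hCN : 0 ≤ CN := by unfold CN; norm_num
  have := mul_le_mul_of_nonneg_right hk (by positivity : 0 ≤ v ^ 18)
  calc CN * ((v ^ 2) ^ 12 + ((max X.card Y.card : ℕ) : ℝ) * (v ^ 2) ^ 9)
      = CN * (v ^ 24 + ((max X.card Y.card : ℕ) : ℝ) * v ^ 18) := by ring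
    _ ≤ CN * (v ^ 24 + v ^ 6 * v ^ 18) := by
        apply mul_le_mul_of_nonneg_left _ hCN
        linarith
    _ = _ := by ring
end
end Rud

namespace Rud
section
open Classical

theorem g_form {K : Type*} [Field K] (g : MvPolynomial (Fin 2) K) (hg : g.totalDegree = 2) :
    ∃ α β lam μ δ : K, ∀ x y, MvPolynomial.eval ![x, y] g =
      MvPolynomial.coeff (Finsupp.single 0 1 + Finsupp.single 1 1) g * x * y + α * x ^ 2
        + β * y ^ 2 + lam * x + μ * y + δ := by
  let c : ℕ → ℕ → K := fun i j =>
    ∑ d ∈ g.support, if d 0 = i ∧ d 1 = j then MvPolynomial.coeff d g else 0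
  have hγ : c 1 1 = MvPolynomial.coeff (Finsupp.single 0 1 + Finsupp.single 1 1) g := by
    have e : ∀ d : Fin 2 →₀ ℕ, (d 0 = 1 ∧ d 1 = 1) ↔
        (Finsupp.single 0 1 + Finsupp.single 1 1 : Fin 2 →₀ ℕ) = d := by
      intro d
      constructor
      · rintro ⟨h1, h2⟩
        ext i
        fin_cases i
        · simp [h1]
        · simp [h2]
      · rintro rfl
        simp
    simp only [c, e]
    rw [Finset.sum_ite_eq]
    split_ifs with h
    · rfl
    · exact (MvPolynomial.notMem_support_iff.1 h).symm
  refine ⟨c 2 0, c 0 2, c 1 0, c 0 1, c 0 0, ?_⟩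
  intro x y
  rw [← hγ, MvPolynomial.eval_eq']
  simp only [c, Finset.sum_mul, ← Finset.sum_add_distrib]
  apply Finset.sum_congr rfl
  intro d hd
  have h1 := (MvPolynomial.le_totalDegree hd).trans hg.le
  rw [Finsupp.sum_fintype _ _ (by simp), Fin.sum_univ_two] at h1
  rw [Fin.prod_univ_two]
  simp only [Matrix.cons_val_zero, Matrix.cons_val_one]
  generalize d 0 = i at *
  generalize d 1 = j at *
  have hi : i ≤ 2 := by omega
  have hj : j ≤ 2 := by omega
  interval_cases i <;> interval_cases j <;>
    first
    | (exfalso; omega)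
    | (simp; try ring)

theorem f_form {K : Type*} [Field K] (f : Polynomial K) (hf : f.natDegree = 2) :
    ∃ a b c : K, a ≠ 0 ∧ ∀ x, f.eval x = a * x ^ 2 + b * x + c := by
  refine ⟨f.coeff 2, f.coeff 1, f.coeff 0, ?_, ?_⟩
  · rw [← hf]
    intro h
    have : f = 0 := Polynomial.leadingCoeff_eq_zero.1 h
    rw [this] at hf
    simp at hf
  · intro x
    rw [Polynomial.eval_eq_sum_range, hf]
    simp [Finset.sum_range_succ]
    ring

theorem f_image {K : Type*} [Field K] (f : Polynomial K) (hf : f.natDegree = 2) (A : Finset K) :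
    A.card ≤ 2 * (A.image (fun x => f.eval x)).card := by
  apply Finset.card_le_mul_card_image
  intro y _
  have hne : f - Polynomial.C y ≠ 0 := by
    intro h
    have : f = Polynomial.C y := sub_eq_zero.1 h
    rw [this] at hf
    simp at hf
  have hd : (f - Polynomial.C y).natDegree ≤ 2 := by
    rw [Polynomial.natDegree_sub_C, hf]
  calc _ ≤ (f - Polynomial.C y).roots.toFinset.card := by
        apply Finset.card_le_card
        intro x hx
        rw [Multiset.mem_toFinset, Polynomial.mem_roots hne]
        simp [(Finset.mem_filter.1 hx).2]
    _ ≤ (f - Polynomial.C y).roots.card := Multiset.toFinset_card_le _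
    _ ≤ _ := (Polynomial.card_roots' _).trans hd

theorem step1 {p : ℕ} [Fact p.Prime] (hp2 : 2 < p) (f : Polynomial (ZMod p)) (hf : f.natDegree = 2)
    (A : Finset (ZMod p)) (v : ℝ) (hv : 1 ≤ v) (hN : (A.card : ℝ) = v ^ 5)
    (hvp : v ^ 16 ≤ (p:ℝ) ^ 2) :
    v ^ 6 / (8 * CN) ≤ ((A ×ˢ A).image (fun q => f.eval q.1 + q.2)).card := by
  have hCN : 1 ≤ CN := by unfold CN; norm_num
  set S := (A ×ˢ A).image (fun q => f.eval q.1 + q.2) with hS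
  have hv6 : 0 < v ^ 6 := by positivity
  by_cases hM : v ^ 6 ≤ S.card
  · refine le_trans (div_le_self hv6.le (by linarith)) hM
  push Not at hM
  obtain ⟨a, b, c, ha, hfe⟩ := f_form f hf
  set Fs := A.image (fun x => f.eval x) with hFs
  have hF1 : (Fs.card : ℝ) ≤ v ^ 5 := by
    rw [← hN]; exact_mod_cast Finset.card_image_le
  have hF2 : v ^ 5 ≤ 2 * Fs.card := by
    have hh : A.card ≤ 2 * Fs.card := by
      rw [hFs]
      convert f_image f hf A
    rw [← hN]; exact_mod_cast hh
  have h2 : (2 : ZMod p) ≠ 0 := by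
    intro h
    have : ((2:ℕ) : ZMod p) = 0 := by exact_mod_cast h
    rw [CharP.cast_eq_zero_iff (ZMod p) p] at this
    have := Nat.le_of_dvd (by norm_num) this
    omega
  let τ : ZMod p × ZMod p × ZMod p → ZMod p × ZMod p × ZMod p := fun t =>
    (t.1 + t.2.1, t.2.1, t.2.2)
  have hτ : Function.Injective τ := by
    intro t t' h
    have h1 : t.2.1 = t'.2.1 := congrArg (fun q => q.2.1) h
    have h3 : t.2.2 = t'.2.2 := congrArg (fun q => q.2.2) h
    have h4 : t.1 + t.2.1 = t'.1 + t'.2.1 := congrArg (fun q => q.1) h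
    rw [h1] at h4
    exact Prod.ext (add_right_cancel h4) (Prod.ext h1 h3)
  have key := energy hp2 (-(2 * a)) a a b (-b) c (neg_ne_zero.2 (mul_ne_zero h2 ha))
    (fun s y => f.eval (s - y)) (by intro x y; simp only [hfe]; ring) S Fs A v (by linarith) hvp
    (by
      rw [hN]
      calc (S.card : ℝ) * Fs.card * v ^ 5 ≤ v ^ 6 * v ^ 5 * v ^ 5 := by
            apply mul_le_mul_of_nonneg_right _ (by positivity)
            exact mul_le_mul hM.le hF1 (by positivity) (by positivity)
        _ = v ^ 16 := by ring) hM.le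
    (hF1.trans (pow_le_pow_right₀ hv (by norm_num)))
    ((A ×ˢ Fs ×ˢ A).image τ) (by
      intro t ht
      obtain ⟨t, ht', rfl⟩ := Finset.mem_image.1 ht
      simp only [Finset.mem_product] at ht' ⊢
      refine ⟨?_, ht'.2.1, ht'.2.2⟩
      obtain ⟨x, hx, hxe⟩ := Finset.mem_image.1 ht'.2.1
      rw [hS, Finset.mem_image]
      refine ⟨(x, t.1), Finset.mem_product.2 ⟨hx, ht'.1⟩, ?_⟩
      simp only [τ] at hxe ⊢
      rw [hxe, add_comm]) S (by
      intro t ht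
      obtain ⟨t, ht', rfl⟩ := Finset.mem_image.1 ht
      simp only [Finset.mem_product] at ht'
      rw [hS, Finset.mem_image]
      refine ⟨(t.1, t.2.2), Finset.mem_product.2 ⟨ht'.1, ht'.2.2⟩, ?_⟩
      simp only [τ, add_sub_cancel_right]
      rw [add_comm])
  rw [Finset.card_image_of_injective _ hτ, Finset.card_product, Finset.card_product] at key
  push_cast at key
  rw [hN] at key
  rw [div_le_iff₀ (by linarith)]
  have h5 : v ^ 10 * (v ^ 5 / 2) ≤ v ^ 5 * (Fs.card * v ^ 5) := by
    have := mul_le_mul_of_nonneg_left hF2 (by positivity : 0 ≤ v ^ 10)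
    nlinarith
  have h6 := pow_le_pow_left₀ (by positivity) h5 2
  have h7 := h6.trans key
  have hv24 : 0 < v ^ 24 := by positivity
  apply le_of_mul_le_mul_left _ hv24
  calc v ^ 24 * v ^ 6 = 4 * (v ^ 10 * (v ^ 5 / 2)) ^ 2 := by ring
    _ ≤ 4 * (S.card * (2 * CN * v ^ 24)) := by linarith
    _ = _ := by ring

theorem final {p : ℕ} [Fact p.Prime] (hp2 : 2 < p) (f : Polynomial (ZMod p)) (hf : f.natDegree = 2)
    (g : MvPolynomial (Fin 2) (ZMod p)) (hg : g.totalDegree = 2)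
    (hγ : MvPolynomial.coeff (Finsupp.single 0 1 + Finsupp.single 1 1) g ≠ 0)
    (A : Finset (ZMod p)) (v : ℝ) (hv : 1 ≤ v) (hN : (A.card : ℝ) = v ^ 5)
    (hvp : v ^ 16 ≤ (p:ℝ) ^ 2) (W : Finset (ZMod p))
    (hW : ∀ x ∈ A, ∀ y ∈ A, ∀ z ∈ A, ∀ w ∈ A, f.eval x + y + MvPolynomial.eval ![z, w] g ∈ W) :
    v ^ 8 / (512 * CN ^ 3) ≤ W.card := by
  have hCN : 1 ≤ CN := by unfold CN; norm_num
  have hs := step1 hp2 f hf A v hv hN hvp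
  set S := (A ×ˢ A).image (fun q => f.eval q.1 + q.2) with hS
  have hv6 : 1 ≤ v ^ 6 := one_le_pow₀ hv
  obtain ⟨B, hBS, hB⟩ := Finset.exists_subset_card_eq (s := S) (n := min S.card ⌊v ^ 6⌋₊) (by omega)
  have hB1 : (B.card : ℝ) ≤ v ^ 6 := by
    refine le_trans ?_ (Nat.floor_le (by positivity : 0 ≤ v ^ 6))
    exact_mod_cast (by omega : B.card ≤ ⌊v ^ 6⌋₊)
  have hB2 : v ^ 6 / (8 * CN) ≤ B.card := by
    rw [hB, Nat.cast_min]
    refine le_min hs ?_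
    have h1 := Nat.lt_floor_add_one (v ^ 6)
    have h3 : (1:ℝ) ≤ ⌊v ^ 6⌋₊ := by
      exact_mod_cast Nat.le_floor (by exact_mod_cast hv6)
    rw [div_le_iff₀ (by linarith)]
    nlinarith
  obtain ⟨α, β, lam, μ, δ, hgf⟩ := g_form g hg
  have h56 : (A.card : ℝ) ≤ v ^ 6 := by rw [hN]; exact pow_le_pow_right₀ hv (by norm_num)
  have key := energy hp2 _ α β lam μ δ hγ (fun x y => MvPolynomial.eval ![x, y] g) hgf A A B v
    (by linarith) hvp
    (by
      rw [hN]
      calc v ^ 5 * v ^ 5 * (B.card : ℝ) ≤ v ^ 5 * v ^ 5 * v ^ 6 :=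
            mul_le_mul_of_nonneg_left hB1 (by positivity)
        _ = v ^ 16 := by ring) h56 h56 (A ×ˢ A ×ˢ B) le_rfl W (by
      intro t ht
      simp only [Finset.mem_product] at ht
      obtain ⟨q, hq, hqe⟩ := Finset.mem_image.1 (hBS ht.2.2)
      rw [← hqe]
      exact hW _ (Finset.mem_product.1 hq).1 _ (Finset.mem_product.1 hq).2 _ ht.1 _ ht.2.1)
  rw [Finset.card_product, Finset.card_product] at key
  push_cast at key
  rw [hN] at key
  have h5 : v ^ 16 / (8 * CN) ≤ v ^ 5 * (v ^ 5 * B.card) := by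
    have := mul_le_mul_of_nonneg_left hB2 (by positivity : 0 ≤ v ^ 10)
    calc v ^ 16 / (8 * CN) = v ^ 10 * (v ^ 6 / (8 * CN)) := by ring
      _ ≤ _ := this
      _ = _ := by ring
  have h6 := (pow_le_pow_left₀ (by positivity) h5 2).trans key
  have hv24 : 0 < v ^ 24 := by positivity
  rw [div_le_iff₀ (by positivity)]
  rw [div_pow, div_le_iff₀ (by positivity)] at h6
  apply le_of_mul_le_mul_left _ hv24
  have hW0 : 0 ≤ (W.card : ℝ) * CN ^ 3 * v ^ 24 := by positivity
  calc v ^ 24 * v ^ 8 = (v ^ 16) ^ 2 := by ring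
    _ ≤ _ := h6
    _ ≤ _ := by nlinarith
end
end Rud

theorem stmt_1 :
    ∃ c : ℝ, 0 < c ∧ ∀ (p : ℕ), p.Prime → 2 < p →
      ∀ (f : Polynomial (ZMod p)), f.natDegree = 2 →
      ∀ (g : MvPolynomial (Fin 2) (ZMod p)), g.totalDegree = 2 →
        MvPolynomial.coeff (Finsupp.single 0 1 + Finsupp.single 1 1) g ≠ 0 →
      ∀ A : Finset (ZMod p), (A.card : ℝ) ≤ (p : ℝ) ^ ((5 : ℝ) / 8) →
      c * (A.card : ℝ) ^ ((8 : ℝ) / 5) ≤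
        ((((A ×ˢ A) ×ˢ (A ×ˢ A)).image
          (fun q => f.eval q.1.1 + q.1.2 + MvPolynomial.eval ![q.2.1, q.2.2] g)).card : ℝ) := by
  have hCN : 1 ≤ Rud.CN := by unfold Rud.CN; norm_num
  refine ⟨1 / (512 * Rud.CN ^ 3), by positivity, ?_⟩
  intro p hp hp2 f hf g hg hγ A hA
  have : Fact p.Prime := ⟨hp⟩
  by_cases hA0 : A.card = 0
  · rw [hA0]
    simp
  have hA1 : (1:ℝ) ≤ A.card := by exact_mod_cast Nat.pos_of_ne_zero hA0
  have hA2 : (0:ℝ) ≤ A.card := by positivity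
  obtain ⟨v, hv⟩ : ∃ v : ℝ, v = (A.card : ℝ) ^ ((1:ℝ) / 5) := ⟨_, rfl⟩
  have hv1 : 1 ≤ v := by rw [hv]; exact Real.one_le_rpow hA1 (by norm_num)
  have hv5 : (A.card : ℝ) = v ^ 5 := by
    rw [hv, ← Real.rpow_natCast, ← Real.rpow_mul hA2]; norm_num
  have hv8 : (A.card : ℝ) ^ ((8:ℝ) / 5) = v ^ 8 := by
    rw [hv, ← Real.rpow_natCast, ← Real.rpow_mul hA2]; norm_num
  have hvp : v ^ 16 ≤ (p:ℝ) ^ 2 := by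
    have h1 := Real.rpow_le_rpow hA2 hA (by norm_num : (0:ℝ) ≤ 8 / 5)
    rw [hv8, ← Real.rpow_mul (by positivity)] at h1
    norm_num at h1
    calc v ^ 16 = (v ^ 8) ^ 2 := by ring
      _ ≤ _ := pow_le_pow_left₀ (by positivity) h1 2
  rw [hv8]
  have := Rud.final hp2 f hf g hg hγ A v hv1 hv5 hvp
    (((A ×ˢ A) ×ˢ (A ×ˢ A)).image
          (fun q => f.eval q.1.1 + q.1.2 + MvPolynomial.eval ![q.2.1, q.2.2] g)) (by
      intro x hx y hy z hz w hw
      exact Finset.mem_image.2 ⟨((x, y), (z, w)), by simp [hx, hy, hz, hw], rfl⟩)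
  calc _ = v ^ 8 / (512 * Rud.CN ^ 3) := by ring
    _ ≤ _ := this
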